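/- arXiv:2011.02931 — 4 statements merged into one kernel-verified Lean document; each statement's English description precedes it below -/
import Mathlib

section
/- Let A be a complex unital Banach algebra and let Λ : A → ℂ be a ℂ-linear functional (not assumed continuous) such that Λ(1) = 1 and Λ(a) ≠ 0 for every invertible element a ∈ A. Then Λ(ab) = Λ(a)Λ(b) for all a, b ∈ A. -/
theorem Multiset.sum_map_sq_eq_esymm {R : Type*} [CommRing R] (s : Multiset R) :
    (s.map (· ^ 2)).sum = s.esymm 1 ^ 2 - 2 * s.esymm 2 := by
  induction s using Multiset.induction with
  | empty => simp [Multiset.esymm, Multiset.powersetCard_zero_right]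
  | cons a s ih =>
    simp only [Multiset.map_cons, Multiset.sum_cons, ih]
    simp [Multiset.esymm, Multiset.powersetCard_one]
    rw [show (s.map fun x => a * x).sum = a * s.sum by
      rw [Multiset.sum_map_mul_left, Multiset.map_id']]
    ring

open Polynomial in
/-- The polynomial whose value at `z` is `Λ ((z - a) ^ n)`. -/
noncomputable def gkzPoly {A : Type*} [Ring A] [Algebra ℂ A] (Λ : A →ₗ[ℂ] ℂ) (a : A) (n : ℕ) :
    ℂ[X] :=
  ∑ k ∈ Finset.range (n + 1), monomial k ((n.choose k : ℂ) * Λ ((-a) ^ (n - k)))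

section Algebraic

variable {A : Type*} [Ring A] [Algebra ℂ A] (Λ : A →ₗ[ℂ] ℂ)

theorem gkzPoly_eval (a : A) (n : ℕ) (z : ℂ) :
    (gkzPoly Λ a n).eval z = Λ ((algebraMap ℂ A z - a) ^ n) := by
  rw [sub_eq_add_neg, (Algebra.commute_algebraMap_left z (-a)).add_pow, map_sum, gkzPoly,
    Polynomial.eval_finsetSum]
  refine Finset.sum_congr rfl fun k _ => ?_
  have : algebraMap ℂ A z ^ k * (-a) ^ (n - k) * (n.choose k : A) =
      (z ^ k * (n.choose k : ℂ)) • (-a) ^ (n - k) := by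
    rw [Algebra.smul_def, map_mul, map_pow, map_natCast, mul_assoc, mul_assoc,
      Nat.cast_comm]
  rw [this, map_smul, Polynomial.eval_monomial, smul_eq_mul]
  ring

theorem gkzPoly_coeff (a : A) {n k : ℕ} (hk : k ≤ n) :
    (gkzPoly Λ a n).coeff k = (n.choose k : ℂ) * Λ ((-a) ^ (n - k)) := by
  simp [gkzPoly, Polynomial.coeff_monomial, hk]

theorem gkzPoly_natDegree_le (a : A) (n : ℕ) : (gkzPoly Λ a n).natDegree ≤ n :=
  Polynomial.natDegree_sum_le_of_forall_le _ _ fun _ hk =>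
    (Polynomial.natDegree_monomial_le _).trans (Nat.lt_succ_iff.1 (Finset.mem_range.1 hk))

variable {Λ}

theorem gkzPoly_coeff_self (h1 : Λ 1 = 1) (a : A) (n : ℕ) : (gkzPoly Λ a n).coeff n = 1 := by
  simp [gkzPoly_coeff, h1]

theorem gkzPoly_monic (h1 : Λ 1 = 1) (a : A) (n : ℕ) : (gkzPoly Λ a n).Monic :=
  Polynomial.monic_of_natDegree_le_of_coeff_eq_one n (gkzPoly_natDegree_le Λ a n)
    (gkzPoly_coeff_self h1 a n)

theorem gkzPoly_natDegree (h1 : Λ 1 = 1) (a : A) (n : ℕ) : (gkzPoly Λ a n).natDegree = n :=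
  le_antisymm (gkzPoly_natDegree_le Λ a n)
    (Polynomial.le_natDegree_of_ne_zero (by simp [gkzPoly_coeff_self h1]))

theorem mem_spectrum_of_mem_roots_gkzPoly (hinv : ∀ a : A, IsUnit a → Λ a ≠ 0) {a : A} {n : ℕ}
    {z : ℂ} (hz : z ∈ (gkzPoly Λ a n).roots) : z ∈ spectrum ℂ a := by
  rw [spectrum.mem_iff]
  intro hu
  apply hinv _ (hu.pow n)
  rw [← gkzPoly_eval]
  exact (Polynomial.mem_roots'.1 hz).2

theorem sum_sq_roots_gkzPoly (h1 : Λ 1 = 1) (a : A) {n : ℕ} (hn : 2 ≤ n) :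
    ((gkzPoly Λ a n).roots.map (· ^ 2)).sum =
      (n : ℂ) ^ 2 * Λ a ^ 2 - n * (n - 1) * Λ (a ^ 2) := by
  have hdeg := gkzPoly_natDegree h1 a n
  have hcard : (gkzPoly Λ a n).roots.card = (gkzPoly Λ a n).natDegree :=
    Polynomial.splits_iff_card_roots.1 (IsAlgClosed.splits _)
  have vieta {j : ℕ} (hj : j ≤ n) := Polynomial.coeff_eq_esymm_roots_of_card hcard
    (k := n - j) (by omega)
  have e1 := vieta (j := 1) (by omega)
  have e2 := vieta hn
  rw [gkzPoly_coeff _ _ (Nat.sub_le _ _), hdeg, (gkzPoly_monic h1 a n).leadingCoeff,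
    Nat.choose_symm (by omega), Nat.sub_sub_self (by omega)] at e1 e2
  rw [Nat.cast_choose_two] at e2
  simp only [Nat.choose_one_right, pow_one, map_neg, even_two.neg_pow, one_pow, one_mul] at e1 e2
  rw [Multiset.sum_map_sq_eq_esymm]
  linear_combination (n * Λ a + (gkzPoly Λ a n).roots.esymm 1) * e1 + 2 * e2

/-- A linear functional that preserves squares is multiplicative. -/
theorem map_mul_of_map_sq (h1 : Λ 1 = 1) (hsq : ∀ a, Λ (a ^ 2) = Λ a ^ 2) (a b : A) :
    Λ (a * b) = Λ a * Λ b := by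
  have jordan (x y : A) : Λ (x * y) + Λ (y * x) = 2 * (Λ x * Λ y) := by
    have h := hsq (x + y)
    rw [show (x + y) ^ 2 = x ^ 2 + (x * y + y * x) + y ^ 2 by noncomm_ring] at h
    simp only [map_add, hsq] at h
    linear_combination h
  have ker (x y : A) (hx : Λ x = 0) : Λ (x * y) = 0 := by
    have hadd := jordan x y
    have htriple := jordan x (y * x * y)
    have hcomm := hsq (x * y - y * x)
    have hanti := hsq (x * y + y * x)
    have hid : (x * y - y * x) ^ 2 + (x * y + y * x) ^ 2 =
        (x * (y * x * y) + y * x * y * x) + (x * (y * x * y) + y * x * y * x) := by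
      noncomm_ring
    have hid' := congrArg Λ hid
    simp only [map_add, map_sub, hx, zero_mul, mul_zero] at hadd htriple hcomm hanti hid'
    have : Λ (x * y) - Λ (y * x) = 0 := by
      rw [← sq_eq_zero_iff, ← hcomm]
      linear_combination hid' - hanti + 2 * htriple - (Λ (x * y) + Λ (y * x)) * hadd
    linear_combination (hadd + this) / 2
  have h := ker (a - Λ a • 1) b (by simp [h1])
  simpa [sub_mul, sub_eq_zero] using h

end Algebraic

/-- A unital linear functional that vanishes on no invertible element preserves squares. -/
theorem map_sq_of_forall_isUnit_ne_zero {A : Type*} [NormedRing A] [NormedAlgebra ℂ A]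
    [CompleteSpace A] {Λ : A →ₗ[ℂ] ℂ} (h1 : Λ 1 = 1) (hinv : ∀ a : A, IsUnit a → Λ a ≠ 0)
    (a : A) : Λ (a ^ 2) = Λ a ^ 2 := by
  obtain ⟨R, hR⟩ := (spectrum.isBounded (𝕜 := ℂ) a).exists_norm_le
  have bound (n : ℕ) (hn : 2 ≤ n) :
      n * ‖Λ a ^ 2 - Λ (a ^ 2)‖ ≤ R ^ 2 + ‖Λ (a ^ 2)‖ := by
    have hsum : ‖((gkzPoly Λ a n).roots.map (· ^ 2)).sum‖ ≤ n * R ^ 2 := by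
      refine (norm_multiset_sum_le _).trans ?_
      rw [Multiset.map_map]
      refine (Multiset.sum_le_card_nsmul _ (R ^ 2) ?_).trans ?_
      · simp only [Multiset.mem_map, Function.comp_apply, norm_pow]
        rintro _ ⟨z, hz, rfl⟩
        gcongr
        exact hR z (mem_spectrum_of_mem_roots_gkzPoly hinv hz)
      · rw [Multiset.card_map, nsmul_eq_mul]
        gcongr
        exact (Polynomial.card_roots' _).trans (gkzPoly_natDegree_le Λ a n)
    rw [sum_sq_roots_gkzPoly h1 a hn, show (n : ℂ) ^ 2 * Λ a ^ 2 - n * (n - 1) * Λ (a ^ 2) =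
      n * (n * (Λ a ^ 2 - Λ (a ^ 2)) + Λ (a ^ 2)) by ring, norm_mul, Complex.norm_natCast] at hsum
    have hn0 : (0 : ℝ) < n := by exact_mod_cast (by omega : 0 < n)
    have h := le_of_mul_le_mul_left hsum hn0
    have htri := norm_sub_le (n * (Λ a ^ 2 - Λ (a ^ 2)) + Λ (a ^ 2)) (Λ (a ^ 2))
    rw [add_sub_cancel_right, norm_mul, Complex.norm_natCast] at htri
    linarith
  by_contra hne
  have hpos : 0 < ‖Λ a ^ 2 - Λ (a ^ 2)‖ := norm_pos_iff.2 (sub_ne_zero.2 (Ne.symm hne))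
  obtain ⟨n, hn⟩ := exists_nat_gt ((R ^ 2 + ‖Λ (a ^ 2)‖) / ‖Λ a ^ 2 - Λ (a ^ 2)‖)
  rw [div_lt_iff₀ hpos] at hn
  have h := bound (n + 2) (by omega)
  push_cast at h
  linarith

/-- **Gleason–Kahane–Żelazko theorem.** If `A` is a complex unital Banach algebra and
`Λ : A → ℂ` is a linear functional (not assumed continuous) with `Λ 1 = 1` that is
non-zero on every invertible element, then `Λ` is multiplicative. -/
theorem gkz_theorem {A : Type*} [NormedRing A] [NormedAlgebra ℂ A] [CompleteSpace A]
    (Λ : A →ₗ[ℂ] ℂ) (h1 : Λ 1 = 1) (hinv : ∀ a : A, IsUnit a → Λ a ≠ 0) :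
    ∀ a b : A, Λ (a * b) = Λ a * Λ b :=
  map_mul_of_map_sq h1 (map_sq_of_forall_isUnit_ne_zero h1 hinv)
end

section
/- Let A be a complex unital Banach algebra, M a left A-module, and S a non-empty subset of M satisfying conditions (S1), (S2), (S3). Let Λ : M → ℂ be a ℂ-linear functional (no topology on M is assumed and no continuity of Λ is assumed) such that Λ(s) ≠ 0 for all s ∈ S. Then there exists a character χ on A such that Λ(a·m) = χ(a)·Λ(m) for all a ∈ A and m ∈ M. -/
open Polynomial in
/-- The degree `N` polynomial `z ↦ φ ((z + a) ^ N)` attached to a linear functional `φ`. -/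
noncomputable def LinearMap.binomialPolynomial {A : Type*} [Ring A] [Algebra ℂ A]
    (φ : A →ₗ[ℂ] ℂ) (a : A) (N : ℕ) : ℂ[X] :=
  ∑ m ∈ Finset.range (N + 1), monomial m (φ (a ^ (N - m)) * (N.choose m : ℂ))

namespace LinearMap

section Algebra

variable {A : Type*} [Ring A] [Algebra ℂ A] (φ : A →ₗ[ℂ] ℂ)

theorem eval_binomialPolynomial (a : A) (N : ℕ) (z : ℂ) :
    (φ.binomialPolynomial a N).eval z = φ ((algebraMap ℂ A z + a) ^ N) := by
  rw [(Algebra.commute_algebraMap_left z a).add_pow, map_sum,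
    binomialPolynomial, Polynomial.eval_finsetSum]
  refine Finset.sum_congr rfl fun m _ => ?_
  rw [Polynomial.eval_monomial, ← map_pow, mul_assoc, ← Algebra.smul_def, ← nsmul_eq_mul',
    map_nsmul, map_smul, smul_eq_mul, nsmul_eq_mul]
  ring

theorem coeff_binomialPolynomial (a : A) (N k : ℕ) :
    (φ.binomialPolynomial a N).coeff k = φ (a ^ (N - k)) * (N.choose k : ℂ) := by
  rw [binomialPolynomial, Polynomial.finsetSum_coeff]
  simp only [Polynomial.coeff_monomial, Finset.sum_ite_eq', Finset.mem_range]
  split_ifs with h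
  · rfl
  · rw [Nat.choose_eq_zero_of_lt (by omega)]
    simp

theorem natDegree_binomialPolynomial (h1 : φ 1 = 1) (a : A) (N : ℕ) :
    (φ.binomialPolynomial a N).natDegree = N := by
  refine Polynomial.natDegree_eq_of_le_of_coeff_ne_zero ?_ ?_
  · refine Polynomial.natDegree_le_iff_coeff_eq_zero.2 fun k hk => ?_
    rw [coeff_binomialPolynomial, Nat.choose_eq_zero_of_lt hk]
    simp
  · simp [coeff_binomialPolynomial, h1]

theorem monic_binomialPolynomial (h1 : φ 1 = 1) (a : A) (N : ℕ) :
    (φ.binomialPolynomial a N).Monic := by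
  rw [Polynomial.Monic, Polynomial.leadingCoeff, natDegree_binomialPolynomial φ h1]
  simp [coeff_binomialPolynomial, h1]

end Algebra

end LinearMap

theorem Multiset.sum_sq_eq_esymm {R : Type*} [CommRing R] (s : Multiset R) :
    s.sum ^ 2 = (s.map fun x => x ^ 2).sum + 2 * s.esymm 2 := by
  induction s using Multiset.induction_on with
  | empty => simp [Multiset.esymm, Multiset.powersetCard_zero_right]
  | cons a s ih =>
    have h : (a ::ₘ s).esymm 2 = s.esymm 2 + a * s.sum := by
      simpa [Multiset.esymm, Multiset.powersetCard_cons, Multiset.powersetCard_one]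
        using Multiset.sum_map_mul_left (s := s) (f := id)
    rw [h, Multiset.sum_cons, Multiset.map_cons, Multiset.sum_cons]
    linear_combination ih

namespace LinearMap

section BanachAlgebra

variable {A : Type*} [NormedRing A] [NormedAlgebra ℂ A] [CompleteSpace A] {φ : A →ₗ[ℂ] ℂ}

theorem norm_root_binomialPolynomial_le (hu : ∀ a, IsUnit a → φ a ≠ 0) {a : A} {N : ℕ}
    {z : ℂ} (hz : (φ.binomialPolynomial a N).eval z = 0) : ‖z‖ ≤ ‖a‖ * ‖(1 : A)‖ := by
  have h : z ∈ spectrum ℂ (-a) := by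
    rw [spectrum.mem_iff, sub_neg_eq_add]
    intro h
    exact hu _ (h.pow N) (by rw [← eval_binomialPolynomial, hz])
  simpa using spectrum.norm_le_norm_mul_of_mem h

theorem map_mul_self_eq_zero (h1 : φ 1 = 1) (hu : ∀ a, IsUnit a → φ a ≠ 0) {a : A}
    (ha : φ a = 0) : φ (a * a) = 0 := by
  set R := ‖a‖ * ‖(1 : A)‖
  have bound (n : ℕ) : n * ‖φ (a * a)‖ ≤ R ^ 2 := by
    set p := φ.binomialPolynomial a (n + 2) with hp
    have hdeg : p.natDegree = n + 2 := natDegree_binomialPolynomial φ h1 a _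
    have hlead : p.leadingCoeff = 1 := monic_binomialPolynomial φ h1 a _
    have hcard : p.roots.card = n + 2 := by
      rw [← hdeg, ← (IsAlgClosed.splits p).natDegree_eq_card_roots]
    have hsum : p.roots.sum = 0 := by
      have h := Polynomial.coeff_eq_esymm_roots_of_splits (IsAlgClosed.splits p)
        (k := n + 1) (by omega)
      rw [hdeg, hlead, hp, coeff_binomialPolynomial, ← hp,
        show n + 2 - (n + 1) = 1 by omega] at h
      simpa [ha, Multiset.esymm, Multiset.powersetCard_one] using h
    have hesymm : p.roots.esymm 2 = φ (a * a) * ((n + 2).choose 2 : ℕ) := by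
      have h := Polynomial.coeff_eq_esymm_roots_of_splits (IsAlgClosed.splits p)
        (k := n) (by omega)
      rw [hdeg, hlead, hp, coeff_binomialPolynomial, ← hp,
        show n + 2 - n = 2 by omega, Nat.choose_symm_add] at h
      rw [← pow_two, h]
      ring
    have hsq : (p.roots.map fun x => x ^ 2).sum = -((n + 2) * (n + 1) * φ (a * a)) := by
      have h := Multiset.sum_sq_eq_esymm p.roots
      rw [hsum, hesymm, Nat.cast_choose_two] at h
      push_cast at h
      linear_combination -h
    have hle : ‖(p.roots.map fun x => x ^ 2).sum‖ ≤ (n + 2) * R ^ 2 := by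
      refine (norm_multiset_sum_le _).trans
        ((Multiset.sum_le_card_nsmul _ (R ^ 2) fun r hr => ?_).trans_eq ?_)
      · simp only [Multiset.map_map, Multiset.mem_map, Function.comp_apply] at hr
        obtain ⟨z, hz, rfl⟩ := hr
        rw [norm_pow]
        exact pow_le_pow_left₀ (norm_nonneg _)
          (norm_root_binomialPolynomial_le hu (Polynomial.isRoot_of_mem_roots hz)) 2
      · simp [hcard]
    rw [hsq, norm_neg, norm_mul, norm_mul] at hle
    have h2 : ‖(n + 2 : ℂ)‖ = n + 2 := by exact_mod_cast Complex.norm_natCast (n + 2)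
    have h3 : ‖(n + 1 : ℂ)‖ = n + 1 := by exact_mod_cast Complex.norm_natCast (n + 1)
    rw [h2, h3, mul_assoc] at hle
    have := le_of_mul_le_mul_left hle (by positivity)
    nlinarith [norm_nonneg (φ (a * a))]
  by_contra hne
  obtain ⟨n, hn⟩ := exists_nat_gt (R ^ 2 / ‖φ (a * a)‖)
  rw [div_lt_iff₀ (norm_pos_iff.2 hne)] at hn
  exact (bound n).not_gt hn

theorem map_mul_self_of_ne_zero (h1 : φ 1 = 1) (hu : ∀ a, IsUnit a → φ a ≠ 0) (a : A) :
    φ (a * a) = φ a * φ a := by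
  have h := map_mul_self_eq_zero h1 hu (a := a - φ a • 1) (by simp [h1])
  simp only [sub_mul, mul_sub, smul_mul_assoc, mul_smul_comm, one_mul, mul_one, map_sub,
    map_smul, smul_eq_mul, h1] at h
  linear_combination h

theorem map_mul_add_mul_swap (h1 : φ 1 = 1) (hu : ∀ a, IsUnit a → φ a ≠ 0) (a b : A) :
    φ (a * b) + φ (b * a) = 2 * φ a * φ b := by
  have h := map_mul_self_of_ne_zero h1 hu (a + b)
  simp only [add_mul, mul_add, map_add] at h
  linear_combination h - map_mul_self_of_ne_zero h1 hu a - map_mul_self_of_ne_zero h1 hu b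

/-- The **Gleason–Kahane–Żelazko theorem**: a unital linear functional on a complex Banach
algebra that does not vanish on invertible elements is multiplicative. -/
theorem map_mul_of_ne_zero (h1 : φ 1 = 1) (hu : ∀ a, IsUnit a → φ a ≠ 0) (a b : A) :
    φ (a * b) = φ a * φ b := by
  have key {c : A} (hc : φ c = 0) : φ (c * b) = 0 := by
    have h := map_mul_add_mul_swap h1 hu c b
    have h' := map_mul_add_mul_swap h1 hu c (b * c * b)
    have hcb := map_mul_self_of_ne_zero h1 hu (c * b)
    have hbc := map_mul_self_of_ne_zero h1 hu (b * c)
    simp only [hc, mul_zero, zero_mul, ← mul_assoc] at h h' hcb hbc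
    rw [hcb, hbc, eq_neg_of_add_eq_zero_right h] at h'
    exact mul_self_eq_zero.1 (by linear_combination h' / 2)
  have h := key (c := a - φ a • 1) (by simp [h1])
  simpa [sub_mul, sub_eq_zero] using h

end BanachAlgebra

end LinearMap

/-- **GKZ theorem for modules.** Let `A` be a complex unital Banach algebra, `M` a left
`A`-module, and `S ⊆ M` a non-empty subset satisfying (S1) `S` generates `M` as an
`A`-module, (S2) `S` is stable under multiplication by invertible elements of `A`, and
(S3) for all `s₁, s₂ ∈ S` there are `a₁, a₂ ∈ A` with `a₁ • S ∪ a₂ • S ⊆ S` and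
`a₁ • s₁ = a₂ • s₂`.  If `Λ : M → ℂ` is a ℂ-linear functional (no continuity assumed;
ℂ acts on `M` through `A`) that is non-zero on `S`, then there is a character `χ` on `A`
with `Λ (a • m) = χ a * Λ m` for all `a, m`. -/
theorem gkz_module {A : Type*} [NormedRing A] [NormedAlgebra ℂ A] [CompleteSpace A]
    {M : Type*} [AddCommGroup M] [Module A M]
    (S : Set M) (hSne : S.Nonempty)
    (hS1 : Submodule.span A S = ⊤)
    (hS2 : ∀ a : A, IsUnit a → ∀ s ∈ S, a • s ∈ S)
    (hS3 : ∀ s₁ ∈ S, ∀ s₂ ∈ S, ∃ a₁ a₂ : A,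
      (∀ s ∈ S, a₁ • s ∈ S) ∧ (∀ s ∈ S, a₂ • s ∈ S) ∧ a₁ • s₁ = a₂ • s₂)
    (Λ : M → ℂ)
    (hadd : ∀ m n : M, Λ (m + n) = Λ m + Λ n)
    (hsmul : ∀ (c : ℂ) (m : M), Λ ((algebraMap ℂ A c) • m) = c * Λ m)
    (hne : ∀ s ∈ S, Λ s ≠ 0) :
    ∃ χ : A →ₐ[ℂ] ℂ, ∀ (a : A) (m : M), Λ (a • m) = χ a * Λ m := by
  let φ (s : M) : A →ₗ[ℂ] ℂ :=
    { toFun := fun a => Λ (a • s) / Λ s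
      map_add' := fun a b => by rw [add_smul, hadd, add_div]
      map_smul' := fun c a => by
        rw [Algebra.smul_def, mul_smul, hsmul, mul_div_assoc, RingHom.id_apply, smul_eq_mul] }
  have φ_apply (s : M) (a : A) : φ s a = Λ (a • s) / Λ s := rfl
  have φ_one {s : M} (hs : s ∈ S) : φ s 1 = 1 := by
    rw [φ_apply, one_smul, div_self (hne s hs)]
  have φ_mul {s : M} (hs : s ∈ S) : ∀ a b : A, φ s (a * b) = φ s a * φ s b :=
    LinearMap.map_mul_of_ne_zero (φ_one hs)
      fun a ha => div_ne_zero (hne _ (hS2 a ha s hs)) (hne s hs)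
  have φ_smul {s : M} (hs : s ∈ S) {b : A} (hb : b • s ∈ S) : φ (b • s) = φ s := by
    ext a
    have h := φ_mul hs a b
    simp only [φ_apply, mul_smul] at h ⊢
    have hs0 := hne s hs
    have hb0 := hne _ hb
    field_simp at h ⊢
    linear_combination h
  have φ_eq {s t : M} (hs : s ∈ S) (ht : t ∈ S) : φ s = φ t := by
    obtain ⟨a, b, ha, hb, hab⟩ := hS3 s hs t ht
    rw [← φ_smul hs (ha s hs), hab, φ_smul ht (hb t ht)]
  obtain ⟨s₀, hs₀⟩ := hSne
  refine ⟨AlgHom.ofLinearMap (φ s₀) (φ_one hs₀) (φ_mul hs₀), fun a m => ?_⟩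
  rw [AlgHom.ofLinearMap_apply]
  have hS {s : M} (hs : s ∈ S) (a : A) : Λ (a • s) = φ s₀ a * Λ s := by
    rw [φ_eq hs₀ hs, φ_apply, div_mul_cancel₀ _ (hne s hs)]
  have hm : m ∈ Submodule.span A S := hS1 ▸ Submodule.mem_top
  induction hm using Submodule.span_induction generalizing a with
  | mem s hs => exact hS hs a
  | zero =>
    have h0 : Λ 0 = 0 := by simpa using hadd 0 0
    simp [h0]
  | add x y _ _ hx hy => rw [smul_add, hadd, hadd, hx, hy, mul_add]
  | smul b x _ hx => rw [← mul_smul, hx, hx, φ_mul hs₀, mul_assoc]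
end

section
/- Let 0 < p ≤ ∞ and let Λ : H^p → ℂ be a ℂ-linear functional (not assumed continuous) such that Λ(1) = 1 and Λ(g) ≠ 0 for every outer function g ∈ H^p. Then there exists w in the open unit disk 𝔻 such that Λ(f) = f(w) for all f ∈ H^p. -/
open MeasureTheory
open scoped ENNReal

noncomputable section

/-- The open unit disk in `ℂ`. -/
def unitDisk : Set ℂ := Metric.ball 0 1

/-- A function on the unit disk is holomorphic if it extends to a function on `ℂ`
that is holomorphic on the disk. -/
def HolOn (f : unitDisk → ℂ) : Prop :=
  ∃ F : ℂ → ℂ, DifferentiableOn ℂ F unitDisk ∧ ∀ z : unitDisk, f z = F z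

/-- The Hardy space `H^p` (`0 < p ≤ ∞`) on the unit disk: for `p = ∞` the bounded
holomorphic functions, and for `p < ∞` the holomorphic functions `f` with
`sup_{0 ≤ r < 1} ∫₀^{2π} |f(r e^{iθ})|^p dθ < ∞`. -/
def hardy (p : ℝ≥0∞) : Set (unitDisk → ℂ) :=
  {f | ∃ F : ℂ → ℂ, DifferentiableOn ℂ F unitDisk ∧ (∀ z : unitDisk, f z = F z) ∧
    (if p = ⊤ then ∃ C : ℝ, ∀ z ∈ unitDisk, ‖F z‖ ≤ C
     else ∃ C : ℝ, ∀ r ∈ Set.Ico (0 : ℝ) 1,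
       (∫ θ in (0:ℝ)..(2 * Real.pi),
         ‖F ((r : ℂ) * Complex.exp ((θ : ℂ) * Complex.I))‖ ^ p.toReal) ≤ C)}

/-- A holomorphic function `g` on the unit disk is *outer* if there is `G : 𝕋 → [0,∞)`
(parametrized by `θ`) with `log G` integrable on `[0, 2π]` such that
`g z = exp( (1/2π) ∫₀^{2π} (e^{iθ}+z)/(e^{iθ}-z) · log G(e^{iθ}) dθ )` on the disk. -/
def IsOuter (g : unitDisk → ℂ) : Prop :=
  HolOn g ∧ ∃ G : ℝ → ℝ, (∀ θ, 0 ≤ G θ) ∧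
    IntervalIntegrable (fun θ => Real.log (G θ)) volume 0 (2 * Real.pi) ∧
    ∀ z : unitDisk, g z = Complex.exp ((2 * (Real.pi : ℂ))⁻¹ *
      ∫ θ in (0:ℝ)..(2 * Real.pi),
        ((Complex.exp ((θ : ℂ) * Complex.I) + (z : ℂ)) /
          (Complex.exp ((θ : ℂ) * Complex.I) - (z : ℂ))) * (Real.log (G θ) : ℂ))

lemma Multiset.sum_sq_eq_sum_map_sq_add_two_mul_esymm (s : Multiset ℂ) :
    s.sum ^ 2 = (s.map (fun x => x ^ 2)).sum + 2 * s.esymm 2 := by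
  induction s using Multiset.induction with
  | empty => simp [Multiset.esymm, Multiset.powersetCard_zero_right]
  | cons a s ih =>
    have h : (a ::ₘ s).esymm 2 = s.esymm 2 + a * s.sum := by
      simp [Multiset.esymm, Multiset.powersetCard_cons, Multiset.powersetCard_one,
        Multiset.map_map]
      exact Multiset.sum_map_mul_left.trans (by simp)
    rw [h, Multiset.sum_cons, Multiset.map_cons, Multiset.sum_cons]
    linear_combination ih

/-- If a normalised linear functional on a complex commutative algebra does not vanish on
`(c - a) ^ n` for `‖c‖ > R`, then it respects the square of `a`. -/
lemma LinearMap.map_sq_of_forall_map_sub_pow_ne_zero {A : Type*} [CommRing A] [Algebra ℂ A]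
    (φ : A →ₗ[ℂ] ℂ) (h1 : φ 1 = 1) (a : A) (R : ℝ)
    (h : ∀ c : ℂ, R < ‖c‖ → ∀ n : ℕ, φ ((algebraMap ℂ A c - a) ^ n) ≠ 0) :
    φ (a ^ 2) = φ a ^ 2 := by
  have key : ∀ n : ℕ, 2 ≤ n → (n : ℝ) * ‖φ a ^ 2 - φ (a ^ 2)‖ ≤ R ^ 2 + ‖φ (a ^ 2)‖ := by
    intro n hn
    set P : Polynomial ℂ := ∑ m ∈ Finset.range (n + 1),
      Polynomial.C ((-1) ^ (n - m) * (n.choose m : ℂ) * φ (a ^ (n - m))) * Polynomial.X ^ m with hP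
    have hcoeff : ∀ m, m ≤ n →
        P.coeff m = (-1) ^ (n - m) * (n.choose m : ℂ) * φ (a ^ (n - m)) := by
      intro m hm
      simp only [hP, Polynomial.finsetSum_coeff, Polynomial.coeff_C_mul_X_pow]
      simp [Finset.sum_ite_eq, Nat.lt_succ_of_le hm]
    have hdeg : P.natDegree ≤ n := by
      refine Polynomial.natDegree_sum_le_of_forall_le _ _ fun m hm => ?_
      exact (Polynomial.natDegree_C_mul_X_pow_le _ _).trans
        (Nat.lt_succ_iff.1 (Finset.mem_range.1 hm))
    have hlead : P.coeff n = 1 := by simp [hcoeff n le_rfl, h1]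
    have hmonic : P.Monic := Polynomial.monic_of_natDegree_le_of_coeff_eq_one n hdeg hlead
    have hnat : P.natDegree = n :=
      le_antisymm hdeg (Polynomial.le_natDegree_of_ne_zero (by simp [hlead]))
    have hcard : P.roots.card = P.natDegree :=
      (IsAlgClosed.splits P).natDegree_eq_card_roots.symm
    have heval : ∀ c : ℂ, P.eval c = φ ((algebraMap ℂ A c - a) ^ n) := by
      intro c
      rw [sub_eq_add_neg, add_pow, map_sum, hP, Polynomial.eval_finsetSum]
      refine Finset.sum_congr rfl fun m _ => ?_
      have : algebraMap ℂ A c ^ m * (-a) ^ (n - m) * (n.choose m : A)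
          = (c ^ m * (-1) ^ (n - m) * (n.choose m : ℂ)) • a ^ (n - m) := by
        rw [Algebra.smul_def, neg_pow a]
        simp only [map_mul, map_pow, map_neg, map_one, map_natCast]
        ring
      rw [this, map_smul]
      simp
      ring
    have hroot : ∀ x ∈ P.roots, ‖x‖ ≤ R := by
      intro x hx
      by_contra! hlt
      exact h x hlt n (by rw [← heval]; exact (Polynomial.mem_roots'.1 hx).2)
    have hR : 0 ≤ R := by
      obtain ⟨x, hx⟩ : ∃ x, x ∈ P.roots :=
        Multiset.card_pos_iff_exists_mem.1 (by omega)
      exact (norm_nonneg x).trans (hroot x hx)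
    have hesymm : P.roots.esymm 1 = P.roots.sum := by
      simp [Multiset.esymm, Multiset.powersetCard_one]
    have e1 := Polynomial.coeff_eq_esymm_roots_of_card hcard (k := n - 1) (by omega)
    have e2 := Polynomial.coeff_eq_esymm_roots_of_card hcard (k := n - 2) (by omega)
    rw [hcoeff _ (by omega), hmonic.leadingCoeff, hnat, show n - (n - 1) = 1 by omega,
      Nat.choose_symm (by omega : 1 ≤ n), hesymm] at e1
    rw [hcoeff _ (by omega), hmonic.leadingCoeff, hnat, show n - (n - 2) = 2 by omega,
      Nat.choose_symm hn, Nat.cast_choose_two] at e2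
    simp only [Nat.choose_one_right, pow_one] at e1
    have hsq := Multiset.sum_sq_eq_sum_map_sq_add_two_mul_esymm P.roots
    have hsum : (P.roots.map (fun x => x ^ 2)).sum
        = n * (n * (φ a ^ 2 - φ (a ^ 2)) + φ (a ^ 2)) := by
      have e1' : P.roots.sum = n * φ a := by linear_combination e1
      rw [e1'] at hsq
      linear_combination -hsq + 2 * e2
    have hle : ‖(P.roots.map (fun x => x ^ 2)).sum‖ ≤ n * R ^ 2 := by
      have := Multiset.le_sum_of_subadditive (norm : ℂ → ℝ) norm_zero.le norm_add_le
        (P.roots.map (fun x => x ^ 2))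
      refine this.trans ?_
      have := Multiset.sum_le_card_nsmul ((P.roots.map (fun x => x ^ 2)).map norm) (R ^ 2) (by
        simp only [Multiset.map_map, Multiset.mem_map]
        rintro _ ⟨x, hx, rfl⟩
        simpa using pow_le_pow_left₀ (norm_nonneg x) (hroot x hx) 2)
      simpa [hcard, hnat] using this
    rw [hsum, norm_mul, Complex.norm_natCast] at hle
    have hn0 : (0 : ℝ) < n := by positivity
    have h3 := le_of_mul_le_mul_left hle hn0
    have h4 := norm_sub_le (n * (φ a ^ 2 - φ (a ^ 2)) + φ (a ^ 2)) (φ (a ^ 2))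
    rw [add_sub_cancel_right, norm_mul, Complex.norm_natCast] at h4
    linarith
  by_contra hne
  have hpos : 0 < ‖φ a ^ 2 - φ (a ^ 2)‖ := norm_pos_iff.2 (sub_ne_zero.2 (Ne.symm hne))
  obtain ⟨n, hn⟩ := exists_nat_gt ((R ^ 2 + ‖φ (a ^ 2)‖) / ‖φ a ^ 2 - φ (a ^ 2)‖)
  rw [div_lt_iff₀ hpos] at hn
  have := key (n + 2) (by omega)
  push_cast at this
  nlinarith

open Filter Topology in
/-- Weak sequential compactness of bounded sets in `L²` of the unit circle, tested against
continuous kernels. -/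
lemma exists_circleIntegrable_weak_limit (v : ℕ → ℂ → ℝ)
    (hv : ∀ n, ContinuousOn (v n) (Metric.sphere 0 1)) (C : ℝ)
    (hC : ∀ n, Real.circleAverage (fun z => v n z ^ 2) 0 1 ≤ C) :
    ∃ u : ℂ → ℝ, CircleIntegrable u 0 1 ∧ ∃ s : ℕ → ℕ, StrictMono s ∧
      ∀ k : ℂ → ℝ, ContinuousOn k (Metric.sphere 0 1) →
        Tendsto (fun n => Real.circleAverage (fun z => k z * v (s n) z) 0 1) atTop
          (𝓝 (Real.circleAverage (fun z => k z * u z) 0 1)) := by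
  set ν : Measure ℝ := volume.restrict (Set.Ioc 0 (2 * Real.pi)) with hν
  have hmap : Measurable (circleMap 0 1) := (continuous_circleMap 0 1).measurable
  set μ : Measure ℂ := ν.map (circleMap 0 1) with hμ
  have : Fact ((2 : ℝ≥0∞) ≠ ⊤) := ⟨by norm_num⟩
  have : IsFiniteMeasure μ := by rw [hμ]; infer_instance
  have hae : ∀ᵐ z ∂μ, z ∈ Metric.sphere (0 : ℂ) 1 :=
    (ae_map_iff hmap.aemeasurable Metric.isClosed_sphere.measurableSet).2
      (.of_forall fun θ => circleMap_mem_sphere 0 zero_le_one θ)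
  have hres : μ.restrict (Metric.sphere 0 1) = μ := Measure.restrict_eq_self_of_ae_mem hae
  have hmem : ∀ f : ℂ → ℝ, ContinuousOn f (Metric.sphere 0 1) → MemLp f 2 μ := by
    intro f hf
    obtain ⟨B, hB⟩ := (isCompact_sphere (0 : ℂ) 1).exists_bound_of_continuousOn hf
    refine MemLp.of_bound ?_ B (hae.mono hB)
    have := hf.aestronglyMeasurable (μ := μ) Metric.isClosed_sphere.measurableSet
    rwa [hres] at this
  have hint : ∀ f : ℂ → ℝ, AEStronglyMeasurable f μ →
      Real.circleAverage f 0 1 = (2 * Real.pi)⁻¹ * ∫ z, f z ∂μ := by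
    intro f hf
    rw [Real.circleAverage_def, hμ, integral_map hmap.aemeasurable hf, hν,
      intervalIntegral.integral_of_le (by positivity), smul_eq_mul]
  let V : ℕ → Lp ℝ 2 μ := fun n => (hmem (v n) (hv n)).toLp
  have hinner : ∀ (f g : ℂ → ℝ) (hf : MemLp f 2 μ) (hg : MemLp g 2 μ),
      inner ℝ hf.toLp hg.toLp = ∫ z, g z * f z ∂μ := by
    intro f g hf hg
    rw [L2.inner_def]
    refine integral_congr_ae ?_
    filter_upwards [hf.coeFn_toLp, hg.coeFn_toLp] with z h1 h2
    simp [h1, h2]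
  have hbound : ∀ n, ‖V n‖ ≤ √(2 * Real.pi * C) := by
    intro n
    refine Real.le_sqrt_of_sq_le ?_
    rw [← real_inner_self_eq_norm_sq, hinner _ _ (hmem (v n) (hv n)) (hmem (v n) (hv n))]
    have := hC n
    rw [hint (fun z => v n z ^ 2) ((hmem (v n) (hv n)).aestronglyMeasurable.pow 2)] at this
    rw [inv_mul_le_iff₀ (by positivity)] at this
    simpa [sq] using this
  have hseq := WeakDual.isSeqCompact_closedBall ℝ (Lp ℝ 2 μ) 0 (√(2 * Real.pi * C))
  obtain ⟨ℓ, -, s, hs, hlim⟩ := hseq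
    (x := fun n => StrongDual.toWeakDual (InnerProductSpace.toDual ℝ (Lp ℝ 2 μ) (V n)))
    (by intro n; simpa using hbound n)
  set U : Lp ℝ 2 μ := (InnerProductSpace.toDual ℝ (Lp ℝ 2 μ)).symm (WeakDual.toStrongDual ℓ)
    with hU
  have hUmem : MemLp U 2 μ := Lp.memLp U
  refine ⟨U, ?_, s, hs, fun k hk => ?_⟩
  · have h1 : Integrable U μ := hUmem.integrable (by norm_num)
    replace h1 := (integrable_map_measure h1.aestronglyMeasurable hmap.aemeasurable).1 h1
    rw [CircleIntegrable, intervalIntegrable_iff_integrableOn_Ioc_of_le (by positivity)]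
    exact h1
  · have h1 := ((WeakDual.eval_continuous (hmem k hk).toLp).tendsto ℓ).comp hlim
    rw [hint (fun z => k z * U z) ((hmem k hk).aestronglyMeasurable.mul hUmem.aestronglyMeasurable)]
    simp_rw [fun n => hint (fun z => k z * v (s n) z)
      ((hmem k hk).aestronglyMeasurable.mul (hmem (v (s n)) (hv _)).aestronglyMeasurable)]
    refine Tendsto.const_mul _ ?_
    have e1 : ℓ (hmem k hk).toLp = ∫ z, k z * U z ∂μ := by
      have : ℓ (hmem k hk).toLp = inner ℝ U (hmem k hk).toLp := by
        rw [hU, InnerProductSpace.toDual_symm_apply]; rfl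
      rw [this, ← hinner _ _ hUmem (hmem k hk), Lp.toLp_coeFn]
    rw [← e1]
    refine h1.congr fun n => ?_
    have : inner ℝ (V (s n)) (hmem k hk).toLp = ∫ z, k z * v (s n) z ∂μ := hinner _ _ _ _
    rw [← this]
    rfl

open Filter Topology in
/-- The real parts of holomorphic functions that are bounded in `L²` of the unit circle converge,
along a subsequence, to the Poisson integral of an integrable function. -/
lemma exists_tendsto_re_circleAverage_poissonKernel (q : ℕ → ℂ → ℂ)
    (hq : ∀ n, DiffContOnCl ℂ (q n) (Metric.ball 0 1)) (C : ℝ)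
    (hC : ∀ n, Real.circleAverage (fun z => (q n z).re ^ 2) 0 1 ≤ C) :
    ∃ u : ℂ → ℝ, CircleIntegrable u 0 1 ∧ ∃ s : ℕ → ℕ, StrictMono s ∧
      ∀ z ∈ Metric.ball (0 : ℂ) 1, Tendsto (fun n => (q (s n) z).re) atTop
        (𝓝 (Real.circleAverage (fun ζ => poissonKernel 0 z ζ * u ζ) 0 1)) := by
  have hcont : ∀ n, ContinuousOn (q n) (Metric.sphere 0 1) := fun n =>
    (hq n).continuousOn_ball.mono Metric.sphere_subset_closedBall
  obtain ⟨u, hu, s, hs, hlim⟩ := exists_circleIntegrable_weak_limit (fun n z => (q n z).re)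
    (fun n => Complex.continuous_re.comp_continuousOn (hcont n)) C hC
  refine ⟨u, hu, s, hs, fun z hz => ?_⟩
  have hk : ContinuousOn (poissonKernel 0 z) (Metric.sphere 0 1) := by
    rw [poissonKernel_eq_re_herglotzRieszKernel]
    have := continuousOn_herglotzRieszKernel_sphere hz
    rw [abs_one] at this
    exact Complex.continuous_re.comp_continuousOn this
  refine (hlim _ hk).congr fun n => ?_
  have h1 := (hq (s n)).circleAverage_poissonKernel_smul hz
  have h2 : CircleIntegrable (poissonKernel 0 z • q (s n)) 0 1 := by
    refine ContinuousOn.circleIntegrable zero_le_one ?_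
    exact hk.smul (hcont (s n))
  rw [← h1, ← Complex.reCLM_apply, ← Complex.reCLM.circleAverage_comp_comm h2]
  simp [Function.comp_def]

/-- The outer function whose boundary modulus has logarithm `u`. -/
def outerFun (u : ℂ → ℝ) (z : ℂ) : ℂ :=
  Complex.exp (Real.circleAverage (fun ζ => herglotzRieszKernel 0 z ζ • (u ζ : ℂ)) 0 1)

lemma CircleIntegrable.complex_ofReal {u : ℂ → ℝ} (hu : CircleIntegrable u 0 1) :
    CircleIntegrable (fun ζ => (u ζ : ℂ)) 0 1 := by
  simp only [CircleIntegrable, intervalIntegrable_iff] at hu ⊢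
  exact Complex.ofRealCLM.integrable_comp hu

lemma outerFun_ne_zero (u : ℂ → ℝ) (z : ℂ) : outerFun u z ≠ 0 := Complex.exp_ne_zero _

lemma differentiableOn_outerFun {u : ℂ → ℝ} (hu : CircleIntegrable u 0 1) :
    DifferentiableOn ℂ (outerFun u) (Metric.ball 0 1) :=
  (differentiableOn_circleAverage_herglotzRieszKernel_smul hu.complex_ofReal).cexp

lemma norm_outerFun {u : ℂ → ℝ} (hu : CircleIntegrable u 0 1) {z : ℂ}
    (hz : z ∈ Metric.ball (0 : ℂ) 1) :
    ‖outerFun u z‖ = Real.exp (Real.circleAverage (fun ζ => poissonKernel 0 z ζ * u ζ) 0 1) := by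
  rw [outerFun, Complex.norm_exp, re_circleAverage_herglotzRieszKernel_smul hu hz,
    ← poissonKernel_eq_re_herglotzRieszKernel]
  rfl

lemma outerFun_add {u v : ℂ → ℝ} (hu : CircleIntegrable u 0 1) (hv : CircleIntegrable v 0 1)
    {z : ℂ} (hz : z ∈ Metric.ball (0 : ℂ) 1) :
    outerFun (u + v) z = outerFun u z * outerFun v z := by
  have hk := continuousOn_herglotzRieszKernel_sphere hz
  rw [outerFun, outerFun, outerFun, ← Complex.exp_add]
  congr 1
  refine Eq.trans ?_ (Real.circleAverage_add (hu.complex_ofReal.continuousOn_smul hk)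
    (hv.complex_ofReal.continuousOn_smul hk))
  congr 1
  ext ζ
  simp [mul_add]

lemma isOuter_outerFun {u : ℂ → ℝ} (hu : CircleIntegrable u 0 1) :
    IsOuter (fun z : unitDisk => outerFun u z) := by
  refine ⟨⟨outerFun u, differentiableOn_outerFun hu, fun _ => rfl⟩,
    fun θ => Real.exp (u (circleMap 0 1 θ)), fun θ => (Real.exp_pos _).le, ?_, fun z => ?_⟩
  · simp only [Real.log_exp]
    exact hu
  · simp [outerFun, Real.circleAverage_def, herglotzRieszKernel_def, circleMap]

open Filter Topology in
lemma eq_const_mul_outerFun_of_norm_eq {u : ℂ → ℝ} (hu : CircleIntegrable u 0 1) {F : ℂ → ℂ}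
    (hF : DifferentiableOn ℂ F (Metric.ball 0 1))
    (h : ∀ z ∈ Metric.ball (0 : ℂ) 1, ‖F z‖ = ‖outerFun u z‖) :
    ∃ c : ℂ, c ≠ 0 ∧ ∀ z ∈ Metric.ball (0 : ℂ) 1, F z = c * outerFun u z := by
  have hD : DifferentiableOn ℂ (fun z => F z / outerFun u z) (Metric.ball 0 1) :=
    hF.div (differentiableOn_outerFun hu) fun z _ => outerFun_ne_zero u z
  have hnorm : ∀ z ∈ Metric.ball (0 : ℂ) 1, ‖F z / outerFun u z‖ = 1 := fun z hz => by
    rw [norm_div, h z hz, div_self (norm_ne_zero_iff.2 (outerFun_ne_zero u z))]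
  have h0 : (0 : ℂ) ∈ Metric.ball (0 : ℂ) 1 := Metric.mem_ball_self one_pos
  have hconst := Complex.eqOn_of_isPreconnected_of_isMaxOn_norm
    (convex_ball (0 : ℂ) 1).isPreconnected Metric.isOpen_ball hD h0
    (fun z hz => ((hnorm z hz).trans (hnorm 0 h0).symm).le)
  refine ⟨F 0 / outerFun u 0, ?_, fun z hz => ?_⟩
  · rw [← norm_ne_zero_iff, hnorm 0 h0]; exact one_ne_zero
  · have := hconst hz
    simp only [Function.const_apply] at this
    rw [← this, div_mul_cancel₀ _ (outerFun_ne_zero u z)]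

lemma DifferentiableOn.diffContOnCl_comp_mul {F : ℂ → ℂ}
    (hF : DifferentiableOn ℂ F (Metric.ball 0 1)) {r : ℝ} (hr : r ∈ Set.Ioo (0 : ℝ) 1) :
    DiffContOnCl ℂ (fun z => F (r * z)) (Metric.ball 0 1) := by
  refine DifferentiableOn.diffContOnCl ?_
  rw [closure_ball _ one_ne_zero]
  refine hF.comp (by fun_prop) fun z hz => ?_
  rw [mem_closedBall_zero_iff] at hz
  rw [mem_ball_zero_iff, norm_mul, Complex.norm_real, Real.norm_of_nonneg hr.1.le]
  nlinarith [hr.1, hr.2, norm_nonneg z]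

open Filter Topology in
lemma DifferentiableOn.tendsto_comp_mul {F : ℂ → ℂ}
    (hF : DifferentiableOn ℂ F (Metric.ball 0 1)) {r : ℕ → ℝ} (hr : Tendsto r atTop (𝓝 1))
    {z : ℂ} (hz : z ∈ Metric.ball (0 : ℂ) 1) :
    Tendsto (fun n => F (r n * z)) atTop (𝓝 (F z)) := by
  have h1 : ContinuousAt F z :=
    (hF.differentiableAt (Metric.isOpen_ball.mem_nhds hz)).continuousAt
  have h2 : Tendsto (fun n => (r n : ℂ) * z) atTop (𝓝 z) := by
    simpa using ((Complex.continuous_ofReal.tendsto 1).comp hr).mul_const z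
  exact h1.tendsto.comp h2

open Filter Topology in
/-- A holomorphic function with positive real part is a constant multiple of an outer function. -/
lemma exists_eq_const_mul_outerFun_of_re_pos {F : ℂ → ℂ}
    (hF : DifferentiableOn ℂ F (Metric.ball 0 1))
    (hpos : ∀ z ∈ Metric.ball (0 : ℂ) 1, 0 < (F z).re) :
    ∃ c : ℂ, c ≠ 0 ∧ ∃ u : ℂ → ℝ, CircleIntegrable u 0 1 ∧
      ∀ z ∈ Metric.ball (0 : ℂ) 1, F z = c * outerFun u z := by
  set Q : ℂ → ℂ := fun z => Complex.log (F z) with hQdef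
  have hQ : DifferentiableOn ℂ Q (Metric.ball 0 1) :=
    hF.clog fun z hz => Complex.mem_slitPlane_iff.2 (Or.inl (hpos z hz))
  obtain ⟨r, -, hr, hr1⟩ := exists_seq_strictMono_tendsto' (zero_lt_one (α := ℝ))
  have hq : ∀ n, DiffContOnCl ℂ (fun z => Q (r n * z)) (Metric.ball 0 1) := fun n =>
    hQ.diffContOnCl_comp_mul (hr n)
  have hmem : ∀ n, ∀ z ∈ Metric.sphere (0 : ℂ) 1, (r n * z : ℂ) ∈ Metric.ball (0 : ℂ) 1 := by
    intro n z hz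
    rw [mem_sphere_zero_iff_norm] at hz
    rw [mem_ball_zero_iff, norm_mul, Complex.norm_real, Real.norm_of_nonneg (hr n).1.le, hz,
      mul_one]
    exact (hr n).2
  obtain ⟨u, hu, s, hs, hlim⟩ := exists_tendsto_re_circleAverage_poissonKernel _ hq
    ((Q 0 ^ 2).re + (Real.pi / 2) ^ 2) fun n => by
      have hc : ContinuousOn (fun z => Q (r n * z)) (Metric.sphere 0 1) :=
        (hq n).continuousOn_ball.mono Metric.sphere_subset_closedBall
      have hi2 : CircleIntegrable (fun z => Q (r n * z) ^ 2) 0 1 :=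
        (hc.pow 2).circleIntegrable zero_le_one
      have hi3 : CircleIntegrable (fun z => (Q (r n * z) ^ 2).re) 0 1 :=
        (Complex.continuous_re.comp_continuousOn (hc.pow 2)).circleIntegrable zero_le_one
      have hmean : Real.circleAverage (fun z => (Q (r n * z) ^ 2).re) 0 1 = (Q 0 ^ 2).re := by
        have h1 : DiffContOnCl ℂ (fun z => Q (r n * z) ^ 2) (Metric.ball 0 |1|) := by
          rw [abs_one]
          simpa only [pow_two, smul_eq_mul] using (hq n).smul (hq n)
        have h2 := h1.circleAverage
        rw [mul_zero] at h2
        rw [← h2, ← Complex.reCLM_apply, ← Complex.reCLM.circleAverage_comp_comm hi2]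
        rfl
      rw [← hmean, ← Real.circleAverage_const ((Real.pi / 2) ^ 2) 0 1,
        ← Real.circleAverage_fun_add hi3 (circleIntegrable_const _ _ _)]
      refine Real.circleAverage_mono
        (((Complex.continuous_re.comp_continuousOn hc).pow 2).circleIntegrable zero_le_one)
        (hi3.add (circleIntegrable_const _ _ _)) fun z hz => ?_
      rw [abs_one] at hz
      have him : |(Q (r n * z)).im| ≤ Real.pi / 2 := by
        rw [hQdef, Complex.log_im]
        exact Complex.abs_arg_le_pi_div_two_iff.2 (hpos _ (hmem n z hz)).le
      have := sq_le_sq' (abs_le.1 him).1 (abs_le.1 him).2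
      simp only [pow_two, Complex.mul_re] at this ⊢
      linarith
  obtain ⟨c, hc, h⟩ := eq_const_mul_outerFun_of_norm_eq hu hF fun z hz => by
    have h1 := hlim z hz
    have h2 := (Complex.continuous_re.tendsto _).comp
      ((hQ.tendsto_comp_mul hr1 hz).comp hs.tendsto_atTop)
    rw [norm_outerFun hu hz, tendsto_nhds_unique h1 h2, hQdef, Complex.log_re,
      Real.exp_log (norm_pos_iff.2 fun h0 => by simpa [h0] using hpos z hz)]
  exact ⟨c, hc, u, hu, h⟩

/-- Uniform approximation on the unit circle by real parts of entire functions. -/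
lemma exists_differentiable_re_sub_le {v : ℂ → ℝ} (hv : ContinuousOn v (Metric.sphere 0 1))
    {ε : ℝ} (hε : 0 < ε) :
    ∃ q : ℂ → ℂ, Differentiable ℂ q ∧ ∀ z ∈ Metric.sphere (0 : ℂ) 1, |(q z).re - v z| ≤ ε := by
  have : Fact ((0 : ℝ) < 1) := ⟨one_pos⟩
  have hsph : ∀ x : AddCircle (1 : ℝ), (x.toCircle : ℂ) ∈ Metric.sphere (0 : ℂ) 1 := fun x => by
    rw [mem_sphere_zero_iff_norm, Circle.norm_coe]
  let w : C(AddCircle (1 : ℝ), ℂ) :=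
    ⟨fun x => (v x.toCircle : ℂ), Complex.continuous_ofReal.comp
      (hv.comp_continuous (by fun_prop) hsph)⟩
  have hspan : ∀ h ∈ Submodule.span ℂ (Set.range (@fourier 1)), ∃ q₁ q₂ : ℂ → ℂ,
      Differentiable ℂ q₁ ∧ Differentiable ℂ q₂ ∧
        ∀ x : AddCircle (1 : ℝ), h x = q₁ x.toCircle + starRingEnd ℂ (q₂ x.toCircle) := by
    intro h hh
    induction hh using Submodule.span_induction with
    | mem h hh =>
      obtain ⟨n, rfl⟩ := hh
      obtain ⟨m, rfl | rfl⟩ := n.eq_nat_or_neg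
      · exact ⟨fun z => z ^ m, 0, by fun_prop, by fun_prop, fun x => by
          simp [fourier_apply, AddCircle.toCircle_nsmul]⟩
      · exact ⟨0, fun z => z ^ m, by fun_prop, by fun_prop, fun x => by
          simp only [fourier_apply, AddCircle.toCircle_zsmul]
          simp [← Circle.coe_inv_eq_conj]⟩
    | zero => exact ⟨0, 0, by fun_prop, by fun_prop, by simp⟩
    | add f g _ _ hf hg =>
      obtain ⟨a, b, ha, hb, hab⟩ := hf
      obtain ⟨c, d, hc, hd, hcd⟩ := hg
      refine ⟨a + c, b + d, ha.add hc, hb.add hd, fun x => ?_⟩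
      simp [hab, hcd]
      ring
    | smul t f _ hf =>
      obtain ⟨a, b, ha, hb, hab⟩ := hf
      refine ⟨t • a, starRingEnd ℂ t • b, ha.const_smul t, hb.const_smul _, fun x => ?_⟩
      simp [hab]
      ring
  have hw : w ∈ closure
      (Submodule.span ℂ (Set.range (@fourier 1)) : Set C(AddCircle (1 : ℝ), ℂ)) := by
    rw [← Submodule.topologicalClosure_coe, span_fourier_closure_eq_top]
    trivial
  obtain ⟨h, hh, hdist⟩ := Metric.mem_closure_iff.1 hw ε hε
  obtain ⟨q₁, q₂, h₁, h₂, hq⟩ := hspan h hh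
  refine ⟨q₁ + q₂, h₁.add h₂, fun z hz => ?_⟩
  obtain ⟨x, hx⟩ := (AddCircle.homeomorphCircle (one_ne_zero (α := ℝ))).surjective
    ⟨z, by simpa [Submonoid.unitSphere] using hz⟩
  rw [AddCircle.homeomorphCircle_apply] at hx
  have hxz : (x.toCircle : ℂ) = z := by rw [hx]
  have h3 := (ContinuousMap.dist_apply_le_dist x).trans hdist.le
  rw [dist_comm, dist_eq_norm, hq] at h3
  refine (Eq.le ?_).trans ((Complex.abs_re_le_norm _).trans h3)
  simp [w, hxz]

lemma norm_circleMap_sub_circleMap_symm (ρ θ t : ℝ) :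
    ‖circleMap 0 1 t - circleMap 0 ρ θ‖ = ‖circleMap 0 1 θ - circleMap 0 ρ t‖ := by
  rw [← sq_eq_sq₀ (norm_nonneg _) (norm_nonneg _), ← Complex.normSq_eq_norm_sq,
    ← Complex.normSq_eq_norm_sq, Complex.normSq_apply, Complex.normSq_apply]
  simp only [circleMap_zero, Complex.sub_re, Complex.sub_im, Complex.re_ofReal_mul,
    Complex.im_ofReal_mul, Complex.exp_ofReal_mul_I_re, Complex.exp_ofReal_mul_I_im]
  linear_combination (1 - ρ ^ 2) * (Real.sin_sq_add_cos_sq t - Real.sin_sq_add_cos_sq θ)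

lemma poissonKernel_circleMap_symm (ρ θ t : ℝ) :
    poissonKernel 0 (circleMap 0 ρ θ) (circleMap 0 1 t)
      = poissonKernel 0 (circleMap 0 ρ t) (circleMap 0 1 θ) := by
  simp only [poissonKernel_def, sub_zero, norm_circleMap_sub_circleMap_symm ρ θ t,
    norm_circleMap_zero]

lemma circleAverage_norm_le_circleAverage_norm {e : ℂ → ℂ} (he : Differentiable ℂ e) {ρ : ℝ}
    (hρ : ρ ∈ Set.Ico (0 : ℝ) 1) :
    Real.circleAverage (fun z => ‖e z‖) 0 ρ ≤ Real.circleAverage (fun z => ‖e z‖) 0 1 := by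
  have hball : ∀ θ, circleMap 0 ρ θ ∈ Metric.ball (0 : ℂ) 1 := fun θ => by
    simpa [abs_of_nonneg hρ.1] using hρ.2
  have hec : Continuous e := he.continuous
  have hne : ∀ θ t, ‖circleMap 0 1 t - circleMap 0 ρ θ‖ ^ 2 ≠ 0 := fun θ t => by
    refine pow_ne_zero 2 (norm_ne_zero_iff.2 (sub_ne_zero.2 fun h => ?_))
    have := congrArg norm h
    simp only [norm_circleMap_zero, abs_one, abs_of_nonneg hρ.1] at this
    exact hρ.2.ne this.symm
  set K : ℝ → ℝ → ℝ := fun θ t => poissonKernel 0 (circleMap 0 ρ θ) (circleMap 0 1 t) with hK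
  have hKdef : ∀ θ t, K θ t = (1 - ρ ^ 2) / ‖circleMap 0 1 t - circleMap 0 ρ θ‖ ^ 2 := fun θ t => by
    simp [hK, poissonKernel_def]
  have hKnonneg : ∀ θ t, 0 ≤ K θ t := fun θ t => by
    rw [hKdef]
    have := hρ.1
    have := hρ.2
    exact div_nonneg (by nlinarith) (by positivity)
  have hKcont : Continuous (Function.uncurry K) := by
    have : Function.uncurry K
        = fun x : ℝ × ℝ => (1 - ρ ^ 2) / ‖circleMap 0 1 x.2 - circleMap 0 ρ x.1‖ ^ 2 := by
      ext ⟨θ, t⟩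
      exact hKdef θ t
    rw [this]
    exact Continuous.div continuous_const
      ((((continuous_circleMap 0 1).comp continuous_snd).sub
        ((continuous_circleMap 0 ρ).comp continuous_fst)).norm.pow 2) (fun x => hne _ _)
  have hKint : ∀ t, ∫ θ in (0 : ℝ)..(2 * Real.pi), K θ t = 2 * Real.pi := by
    intro t
    have hball' : circleMap 0 ρ t ∈ Metric.ball (0 : ℂ) 1 := hball t
    have h1 := (diffContOnCl_const (𝕜 := ℂ) (c := (1 : ℂ))).circleAverage_poissonKernel_smul hball'
    rw [Real.circleAverage_def] at h1
    have h2 : ∫ θ in (0 : ℝ)..(2 * Real.pi), (K θ t : ℂ) = 2 * Real.pi := by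
      rw [inv_smul_eq_iff₀ Real.two_pi_pos.ne'] at h1
      refine Eq.trans ?_ (h1.trans (by simp))
      refine intervalIntegral.integral_congr fun θ _ => ?_
      simp [hK, poissonKernel_circleMap_symm ρ θ t]
    rw [intervalIntegral.integral_ofReal] at h2
    exact_mod_cast h2
  set g : ℝ → ℝ := fun t => ‖e (circleMap 0 1 t)‖ with hg
  have hgcont : Continuous g := (hec.comp (continuous_circleMap 0 1)).norm
  have hpoint : ∀ θ, ‖e (circleMap 0 ρ θ)‖ ≤
      (2 * Real.pi)⁻¹ * ∫ t in (0 : ℝ)..(2 * Real.pi), K θ t * g t := by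
    intro θ
    have h1 := (he.diffContOnCl (s := Metric.ball 0 1)).circleAverage_poissonKernel_smul (hball θ)
    rw [← h1, Real.circleAverage_def, norm_smul, Real.norm_of_nonneg (by positivity)]
    refine mul_le_mul_of_nonneg_left ?_ (by positivity)
    refine (intervalIntegral.norm_integral_le_integral_norm (by positivity)).trans (Eq.le ?_)
    refine intervalIntegral.integral_congr fun t _ => ?_
    simp only [Pi.smul_apply', norm_smul, hg]
    rw [Real.norm_of_nonneg (hKnonneg θ t)]
  rw [Real.circleAverage_def, Real.circleAverage_def, smul_eq_mul, smul_eq_mul]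
  refine mul_le_mul_of_nonneg_left ?_ (by positivity)
  have hint : Continuous (Function.uncurry fun θ t => K θ t * g t) :=
    hKcont.mul (hgcont.comp continuous_snd)
  calc ∫ θ in (0 : ℝ)..(2 * Real.pi), ‖e (circleMap 0 ρ θ)‖
      ≤ ∫ θ in (0 : ℝ)..(2 * Real.pi),
          (2 * Real.pi)⁻¹ * ∫ t in (0 : ℝ)..(2 * Real.pi), K θ t * g t := by
        refine intervalIntegral.integral_mono_on (by positivity) ?_ ?_ fun θ _ => hpoint θ
        · exact (hec.comp (continuous_circleMap 0 ρ)).norm.intervalIntegrable _ _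
        · exact (continuous_const.mul
            (intervalIntegral.continuous_parametric_intervalIntegral_of_continuous' hint _ _)
            ).intervalIntegrable _ _
    _ = (2 * Real.pi)⁻¹ * ∫ t in (0 : ℝ)..(2 * Real.pi),
          ∫ θ in (0 : ℝ)..(2 * Real.pi), K θ t * g t := by
        rw [intervalIntegral.integral_const_mul]
        congr 1
        simp only [intervalIntegral.integral_of_le Real.two_pi_pos.le]
        refine integral_integral_swap ?_
        rw [Measure.prod_restrict]
        exact (hint.continuousOn.integrableOn_compact
          (isCompact_Icc.prod isCompact_Icc)).mono_set
            (Set.prod_mono Set.Ioc_subset_Icc_self Set.Ioc_subset_Icc_self)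
    _ = ∫ t in (0 : ℝ)..(2 * Real.pi), ‖e (circleMap 0 1 t)‖ := by
        simp only [intervalIntegral.integral_mul_const, hKint,
          intervalIntegral.integral_const_mul]
        rw [← mul_assoc, inv_mul_cancel₀ Real.two_pi_pos.ne', one_mul]

open Filter Topology in
/-- Fatou's lemma for circle averages. -/
lemma circleAverage_le_of_tendsto {f : ℕ → ℂ → ℝ} {g : ℂ → ℝ} {ρ B : ℝ}
    (hf : ∀ n, ContinuousOn (f n) (Metric.sphere 0 |ρ|))
    (hg : ContinuousOn g (Metric.sphere 0 |ρ|))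
    (h0 : ∀ n, ∀ z ∈ Metric.sphere (0 : ℂ) |ρ|, 0 ≤ f n z)
    (hlim : ∀ z ∈ Metric.sphere (0 : ℂ) |ρ|, Tendsto (fun n => f n z) atTop (𝓝 (g z)))
    (hB : ∀ n, Real.circleAverage (f n) 0 ρ ≤ B) : Real.circleAverage g 0 ρ ≤ B := by
  set μ : Measure ℝ := volume.restrict (Set.Ioc 0 (2 * Real.pi))
  have hs : ∀ θ, circleMap 0 ρ θ ∈ Metric.sphere (0 : ℂ) |ρ| := fun θ =>
    circleMap_mem_sphere' 0 ρ θ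
  have hfc : ∀ n, Continuous fun θ => f n (circleMap 0 ρ θ) := fun n =>
    (hf n).comp_continuous (continuous_circleMap 0 ρ) hs
  have hgc : Continuous fun θ => g (circleMap 0 ρ θ) :=
    hg.comp_continuous (continuous_circleMap 0 ρ) hs
  have hg0 : ∀ θ, 0 ≤ g (circleMap 0 ρ θ) := fun θ =>
    ge_of_tendsto' (hlim _ (hs θ)) fun n => h0 n _ (hs θ)
  have havg : ∀ h : ℂ → ℝ, Real.circleAverage h 0 ρ = (2 * Real.pi)⁻¹ *
      ∫ θ, h (circleMap 0 ρ θ) ∂μ := fun h => by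
    rw [Real.circleAverage_def, smul_eq_mul, intervalIntegral.integral_of_le Real.two_pi_pos.le]
  simp only [havg] at hB ⊢
  have hB' : ∀ n, ∫ θ, f n (circleMap 0 ρ θ) ∂μ ≤ 2 * Real.pi * B := fun n => by
    have := hB n
    rwa [inv_mul_le_iff₀ Real.two_pi_pos] at this
  rw [inv_mul_le_iff₀ Real.two_pi_pos]
  have hBnonneg : 0 ≤ 2 * Real.pi * B :=
    (integral_nonneg fun θ => h0 0 _ (hs θ)).trans (hB' 0)
  rw [integral_eq_lintegral_of_nonneg_ae (ae_of_all _ hg0) hgc.aestronglyMeasurable]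
  refine ENNReal.toReal_le_of_le_ofReal hBnonneg ?_
  calc ∫⁻ θ, ENNReal.ofReal (g (circleMap 0 ρ θ)) ∂μ
      = ∫⁻ θ, liminf (fun n => ENNReal.ofReal (f n (circleMap 0 ρ θ))) atTop ∂μ := by
        refine lintegral_congr fun θ => ?_
        exact ((ENNReal.continuous_ofReal.tendsto _).comp (hlim _ (hs θ))).liminf_eq.symm
    _ ≤ liminf (fun n => ∫⁻ θ, ENNReal.ofReal (f n (circleMap 0 ρ θ)) ∂μ) atTop :=
        lintegral_liminf_le fun n => (hfc n).measurable.ennreal_ofReal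
    _ ≤ ENNReal.ofReal (2 * Real.pi * B) := by
        refine liminf_le_of_le (by isBoundedDefault) fun b hb => ?_
        obtain ⟨n, hn⟩ := hb.exists
        refine hn.trans ?_
        rw [← ofReal_integral_eq_lintegral_ofReal]
        · exact ENNReal.ofReal_le_ofReal (hB' n)
        · exact ((hfc n).intervalIntegrable 0 (2 * Real.pi)).1
        · exact ae_of_all _ fun θ => h0 n _ (hs θ)

open Filter Topology in
/-- A function in `H^p` is dominated by an outer function in `H^p` with modulus at least `1`. -/
lemma exists_norm_le_norm_outerFun {p : ℝ} (hp : 0 < p) {f : ℂ → ℂ}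
    (hf : DifferentiableOn ℂ f (Metric.ball 0 1)) {C : ℝ}
    (hC : ∀ r ∈ Set.Ico (0 : ℝ) 1, Real.circleAverage (fun z => ‖f z‖ ^ p) 0 r ≤ C) :
    ∃ u : ℂ → ℝ, CircleIntegrable u 0 1 ∧
      (∀ z ∈ Metric.ball (0 : ℂ) 1, 1 ≤ ‖outerFun u z‖ ∧ ‖f z‖ ≤ ‖outerFun u z‖) ∧
      ∃ C', ∀ r ∈ Set.Ico (0 : ℝ) 1,
        Real.circleAverage (fun z => ‖outerFun u z‖ ^ p) 0 r ≤ C' := by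
  obtain ⟨r, -, hr, hr1⟩ := exists_seq_strictMono_tendsto' (zero_lt_one (α := ℝ))
  have hF : ∀ n, DiffContOnCl ℂ (fun z => f (r n * z)) (Metric.ball 0 1) := fun n =>
    hf.diffContOnCl_comp_mul (hr n)
  have hFc : ∀ n, ContinuousOn (fun z => f (r n * z)) (Metric.sphere 0 1) := fun n =>
    (hF n).continuousOn_ball.mono Metric.sphere_subset_closedBall
  have hv : ∀ n, ContinuousOn (fun z => Real.log (1 + ‖f (r n * z)‖) + 1 / 2)
      (Metric.sphere 0 1) := fun n =>
    ((continuousOn_const.add (hFc n).norm).log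
      fun z _ => (add_pos_of_pos_of_nonneg one_pos (norm_nonneg _)).ne').add continuousOn_const
  choose q hqd hq using fun n => exists_differentiable_re_sub_le (hv n) one_half_pos
  have hlow : ∀ n, ∀ z ∈ Metric.sphere (0 : ℂ) 1, Real.log (1 + ‖f (r n * z)‖) ≤ (q n z).re :=
    fun n z hz => by linarith [(abs_le.1 (hq n z hz)).1]
  have hupp : ∀ n, ∀ z ∈ Metric.sphere (0 : ℂ) 1,
      (q n z).re ≤ Real.log (1 + ‖f (r n * z)‖) + 1 :=
    fun n z hz => by linarith [(abs_le.1 (hq n z hz)).2]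
  have hnonneg : ∀ n, ∀ z ∈ Metric.sphere (0 : ℂ) 1, 0 ≤ (q n z).re := fun n z hz =>
    (Real.log_nonneg (by linarith [norm_nonneg (f (r n * z))])).trans (hlow n z hz)
  have hrec : ∀ n, Continuous fun z => (q n z).re := fun n =>
    Complex.continuous_re.comp (hqd n).continuous
  have hexpB : ∀ n, Real.circleAverage (fun z => Real.exp (p * (q n z).re)) 0 1
      ≤ Real.exp p * 2 ^ p * (1 + C) := by
    intro n
    have hi : CircleIntegrable (fun z => ‖f (r n * z)‖ ^ p) 0 1 :=
      ((hFc n).norm.rpow_const fun z _ => Or.inr hp.le).circleIntegrable zero_le_one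
    have h1 : Real.circleAverage (fun z => ‖f (r n * z)‖ ^ p) 0 1 ≤ C := by
      refine Eq.trans_le ?_ (hC (r n) ⟨(hr n).1.le, (hr n).2⟩)
      rw [Real.circleAverage_eq_circleAverage_zero_one (R := r n)]
      simp
    have h2 : Real.circleAverage (fun z => Real.exp p * 2 ^ p * (1 + ‖f (r n * z)‖ ^ p)) 0 1
        = Real.exp p * 2 ^ p *
          (1 + Real.circleAverage (fun z => ‖f (r n * z)‖ ^ p) 0 1) := by
      have := Real.circleAverage_fun_add (circleIntegrable_const (1 : ℝ) 0 1) hi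
      rw [Real.circleAverage_const] at this
      rw [← this, ← smul_eq_mul (Real.exp p * 2 ^ p), ← Real.circleAverage_fun_smul]
      simp only [smul_eq_mul]
    refine le_trans ?_ (h2.le.trans (by gcongr))
    refine Real.circleAverage_mono
      ((Real.continuous_exp.comp ((hrec n).const_mul p)).continuousOn.circleIntegrable zero_le_one)
      (((circleIntegrable_const (1 : ℝ) 0 1).add hi).const_smul (a := Real.exp p * 2 ^ p))
      fun z hz => ?_
    rw [abs_one] at hz
    have hx : 0 ≤ ‖f (r n * z)‖ := norm_nonneg _
    set x := ‖f (r n * z)‖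
    have h3 : Real.exp (p * (q n z).re) ≤ Real.exp p * (1 + x) ^ p := by
      rw [Real.rpow_def_of_pos (by positivity), ← Real.exp_add]
      have := mul_le_mul_of_nonneg_left (hupp n z hz) hp.le
      exact Real.exp_le_exp.2 (by linarith)
    refine h3.trans ?_
    rw [mul_assoc]
    refine mul_le_mul_of_nonneg_left ?_ (Real.exp_pos _).le
    have h4 : (1 + x) ^ p ≤ (2 * max 1 x) ^ p :=
      Real.rpow_le_rpow (by positivity) (by linarith [le_max_left 1 x, le_max_right 1 x]) hp.le
    refine h4.trans ?_
    rw [Real.mul_rpow zero_le_two (by positivity)]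
    refine mul_le_mul_of_nonneg_left ?_ (by positivity)
    rcases max_choice 1 x with h | h <;> rw [h]
    · rw [Real.one_rpow]
      linarith [Real.rpow_nonneg hx p]
    · linarith
  have hB : ∀ n, Real.circleAverage (fun z => (q n z).re ^ 2) 0 1
      ≤ 2 / p ^ 2 * (Real.exp p * 2 ^ p * (1 + C)) := by
    intro n
    have hi : CircleIntegrable (fun z => Real.exp (p * (q n z).re)) 0 1 :=
      (Real.continuous_exp.comp ((hrec n).const_mul p)).continuousOn.circleIntegrable zero_le_one
    refine le_trans ?_ (mul_le_mul_of_nonneg_left (hexpB n) (by positivity))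
    rw [← smul_eq_mul, ← Real.circleAverage_fun_smul]
    refine Real.circleAverage_mono (((hrec n).pow 2).continuousOn.circleIntegrable zero_le_one)
      (hi.const_smul (a := 2 / p ^ 2)) fun z hz => ?_
    rw [abs_one] at hz
    have h1 := Real.quadratic_le_exp_of_nonneg (mul_nonneg hp.le (hnonneg n z hz))
    have h2 := mul_nonneg hp.le (hnonneg n z hz)
    rw [smul_eq_mul, div_mul_eq_mul_div, le_div_iff₀ (by positivity)]
    nlinarith
  obtain ⟨u, hu, s, hs, hlim⟩ := exists_tendsto_re_circleAverage_poissonKernel q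
    (fun n => (hqd n).diffContOnCl) _ hB
  have hbd : Bornology.IsBounded (Metric.ball (0 : ℂ) 1) := Metric.isBounded_ball
  have hclos : ∀ z ∈ Metric.ball (0 : ℂ) 1, z ∈ closure (Metric.ball (0 : ℂ) 1) := fun z hz =>
    subset_closure hz
  have hq0 : ∀ n, ∀ z ∈ Metric.ball (0 : ℂ) 1, 0 ≤ (q n z).re := by
    intro n z hz
    have h1 := Complex.norm_le_of_forall_mem_frontier_norm_le (f := fun z => Complex.exp (-q n z))
      (C := 1) hbd (hqd n).neg.cexp.diffContOnCl (fun z hz => by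
        rw [frontier_ball _ one_ne_zero] at hz
        simpa [Complex.norm_exp] using hnonneg n z hz) (hclos z hz)
    simpa [Complex.norm_exp] using h1
  have hqf : ∀ n, ∀ z ∈ Metric.ball (0 : ℂ) 1, ‖f (r n * z)‖ ≤ Real.exp (q n z).re := by
    intro n z hz
    have h1 := Complex.norm_le_of_forall_mem_frontier_norm_le
      (f := fun z => f (r n * z) * Complex.exp (-q n z))
      (C := 1) hbd ((hF n).smul (hqd n).neg.cexp.diffContOnCl) (fun z hz => by
        rw [frontier_ball _ one_ne_zero] at hz
        have h2 := hlow n z hz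
        rw [Real.log_le_iff_le_exp (by positivity)] at h2
        rw [norm_mul, Complex.norm_exp, Complex.neg_re, Real.exp_neg, ← div_eq_mul_inv,
          div_le_one (Real.exp_pos _)]
        linarith) (hclos z hz)
    rwa [norm_mul, Complex.norm_exp, Complex.neg_re, Real.exp_neg, ← div_eq_mul_inv,
      div_le_one (Real.exp_pos _)] at h1
  refine ⟨u, hu, fun z hz => ⟨?_, ?_⟩, Real.exp p * 2 ^ p * (1 + C), fun ρ hρ => ?_⟩
  · rw [norm_outerFun hu hz, Real.one_le_exp_iff]
    exact ge_of_tendsto' (hlim z hz) fun n => hq0 _ z hz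
  · rw [norm_outerFun hu hz]
    exact le_of_tendsto_of_tendsto' ((hf.tendsto_comp_mul hr1 hz).comp hs.tendsto_atTop).norm
      ((Real.continuous_exp.tendsto _).comp (hlim z hz)) fun n => hqf _ z hz
  · have hsub : Metric.sphere (0 : ℂ) |ρ| ⊆ Metric.ball 0 1 := by
      rw [abs_of_nonneg hρ.1]
      exact Metric.sphere_subset_ball hρ.2
    refine circleAverage_le_of_tendsto (f := fun n z => Real.exp (p * (q (s n) z).re))
      (fun n => (Real.continuous_exp.comp ((hrec (s n)).const_mul p)).continuousOn)
      (((differentiableOn_outerFun hu).continuousOn.mono hsub).norm.rpow_const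
        fun z _ => Or.inr hp.le)
      (fun n z _ => (Real.exp_pos _).le) (fun z hz => ?_) fun n => ?_
    · rw [norm_outerFun hu (hsub hz), ← Real.exp_mul, mul_comm _ p]
      exact (Real.continuous_exp.tendsto _).comp ((hlim z (hsub hz)).const_mul p)
    · refine le_trans ?_ (hexpB (s n))
      have := circleAverage_norm_le_circleAverage_norm (e := fun z => Complex.exp (p * q (s n) z))
        ((hqd (s n)).const_mul (p : ℂ)).cexp hρ
      simpa [Complex.norm_exp] using this

/-- The bounds defining the Hardy space `H^p`, for functions on `ℂ` and in terms of circle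
averages. -/
def MemHardy (p : ℝ≥0∞) (F : ℂ → ℂ) : Prop :=
  DifferentiableOn ℂ F (Metric.ball 0 1) ∧
    (if p = ⊤ then ∃ C : ℝ, ∀ z ∈ Metric.ball (0 : ℂ) 1, ‖F z‖ ≤ C
     else ∃ C : ℝ, ∀ r ∈ Set.Ico (0 : ℝ) 1,
       Real.circleAverage (fun z => ‖F z‖ ^ p.toReal) 0 r ≤ C)

lemma exists_integral_le_iff_exists_circleAverage_le (F : ℂ → ℂ) (q : ℝ) :
    (∃ C : ℝ, ∀ r ∈ Set.Ico (0 : ℝ) 1, (∫ θ in (0 : ℝ)..(2 * Real.pi),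
      ‖F ((r : ℂ) * Complex.exp ((θ : ℂ) * Complex.I))‖ ^ q) ≤ C) ↔
    ∃ C : ℝ, ∀ r ∈ Set.Ico (0 : ℝ) 1, Real.circleAverage (fun z => ‖F z‖ ^ q) 0 r ≤ C := by
  simp only [Real.circleAverage_def, circleMap_zero, smul_eq_mul,
    inv_mul_le_iff₀ Real.two_pi_pos]
  refine ⟨fun ⟨C, hC⟩ => ⟨C / (2 * Real.pi), fun r hr => ?_⟩,
    fun ⟨C, hC⟩ => ⟨2 * Real.pi * C, hC⟩⟩
  rw [mul_div_cancel₀ _ Real.two_pi_pos.ne']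
  exact hC r hr

lemma mem_hardy_iff {p : ℝ≥0∞} {f : unitDisk → ℂ} :
    f ∈ hardy p ↔ ∃ F, MemHardy p F ∧ f = fun z : unitDisk => F z := by
  simp only [hardy, Set.mem_ofPred_eq, MemHardy, exists_integral_le_iff_exists_circleAverage_le,
    funext_iff]
  exact exists_congr fun F => ⟨fun h => ⟨⟨h.1, h.2.2⟩, h.2.1⟩, fun h => ⟨h.1.1, h.2, h.1.2⟩⟩

lemma MemHardy.of_norm_le {p : ℝ≥0∞} {A F : ℂ → ℂ} (hA : MemHardy p A)
    (hF : DifferentiableOn ℂ F (Metric.ball 0 1)) {K : ℝ} (hK : 0 ≤ K)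
    (h : ∀ z ∈ Metric.ball (0 : ℂ) 1, ‖F z‖ ≤ K * (1 + ‖A z‖)) : MemHardy p F := by
  refine ⟨hF, ?_⟩
  have hA2 := hA.2
  split_ifs at hA2 ⊢ with hp
  · obtain ⟨C, hC⟩ := hA2
    exact ⟨K * (1 + C), fun z hz => (h z hz).trans (by gcongr; exact hC z hz)⟩
  · obtain ⟨C, hC⟩ := hA2
    have hq : 0 ≤ p.toReal := ENNReal.toReal_nonneg
    set q := p.toReal
    refine ⟨K ^ q * (2 ^ q * (1 + C)), fun r hr => ?_⟩
    have hsub : Metric.sphere (0 : ℂ) r ⊆ Metric.ball 0 1 := Metric.sphere_subset_ball hr.2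
    have hi : ∀ {G : ℂ → ℂ}, DifferentiableOn ℂ G (Metric.ball 0 1) →
        CircleIntegrable (fun z => ‖G z‖ ^ q) 0 r := fun hG =>
      ((hG.continuousOn.mono hsub).norm.rpow_const fun z _ => Or.inr hq).circleIntegrable hr.1
    have h2 : Real.circleAverage (fun z => K ^ q * (2 ^ q * (1 + ‖A z‖ ^ q))) 0 r
        = K ^ q * (2 ^ q * (1 + Real.circleAverage (fun z => ‖A z‖ ^ q) 0 r)) := by
      have := Real.circleAverage_fun_add (circleIntegrable_const (1 : ℝ) 0 r) (hi hA.1)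
      rw [Real.circleAverage_const] at this
      rw [← this, ← mul_assoc, ← smul_eq_mul (K ^ q * 2 ^ q), ← Real.circleAverage_fun_smul]
      simp only [smul_eq_mul, mul_assoc]
    refine le_trans ?_ (h2.le.trans (by gcongr; exact hC r hr))
    refine Real.circleAverage_mono (hi hF)
      ((((circleIntegrable_const (1 : ℝ) 0 r).add (hi hA.1)).const_smul
        (a := (2 : ℝ) ^ q)).const_smul (a := K ^ q)) fun z hz => ?_
    rw [abs_of_nonneg hr.1] at hz
    have hx : 0 ≤ ‖A z‖ := norm_nonneg _
    set x := ‖A z‖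
    refine (Real.rpow_le_rpow (norm_nonneg _) (h z (hsub hz)) hq).trans ?_
    rw [Real.mul_rpow hK (by positivity)]
    refine mul_le_mul_of_nonneg_left ?_ (by positivity)
    have h4 : (1 + x) ^ q ≤ (2 * max 1 x) ^ q :=
      Real.rpow_le_rpow (by positivity) (by linarith [le_max_left 1 x, le_max_right 1 x]) hq
    refine h4.trans ?_
    rw [Real.mul_rpow zero_le_two (by positivity)]
    refine mul_le_mul_of_nonneg_left ?_ (by positivity)
    rcases max_choice 1 x with h | h <;> rw [h]
    · rw [Real.one_rpow]
      linarith [Real.rpow_nonneg hx q]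
    · linarith

lemma memHardy_const (p : ℝ≥0∞) (c : ℂ) : MemHardy p fun _ => c := by
  refine ⟨differentiableOn_const c, ?_⟩
  split_ifs
  · exact ⟨‖c‖, fun _ _ => le_rfl⟩
  · exact ⟨‖c‖ ^ p.toReal, fun r _ => (Real.circleAverage_const _ _ _).le⟩

lemma memHardy_of_bounded (p : ℝ≥0∞) {F : ℂ → ℂ}
    (hF : DifferentiableOn ℂ F (Metric.ball 0 1)) {C : ℝ}
    (hC : ∀ z ∈ Metric.ball (0 : ℂ) 1, ‖F z‖ ≤ C) : MemHardy p F :=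
  (memHardy_const p 0).of_norm_le hF
    ((norm_nonneg _).trans (hC 0 (Metric.mem_ball_self one_pos))) (by simpa using hC)

lemma MemHardy.bounded_mul {p : ℝ≥0∞} {A a : ℂ → ℂ} (hA : MemHardy p A)
    (ha : DifferentiableOn ℂ a (Metric.ball 0 1)) {C : ℝ}
    (hC : ∀ z ∈ Metric.ball (0 : ℂ) 1, ‖a z‖ ≤ C) : MemHardy p (a * A) := by
  have hC0 : 0 ≤ C := (norm_nonneg _).trans (hC 0 (Metric.mem_ball_self one_pos))
  refine hA.of_norm_le (ha.mul hA.1) hC0 fun z hz => ?_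
  rw [Pi.mul_apply, norm_mul]
  exact mul_le_mul (hC z hz) (by linarith) (norm_nonneg _) hC0

lemma MemHardy.const_smul {p : ℝ≥0∞} {A : ℂ → ℂ} (hA : MemHardy p A) (c : ℂ) :
    MemHardy p (c • A) :=
  hA.bounded_mul (a := fun _ => c) (differentiableOn_const c) (C := ‖c‖) fun _ _ => le_rfl

/-- A nonzero constant multiple of an outer function. -/
def IsScaledOuter (F : ℂ → ℂ) : Prop :=
  ∃ c : ℂ, c ≠ 0 ∧ ∃ u : ℂ → ℝ, CircleIntegrable u 0 1 ∧
    ∀ z ∈ Metric.ball (0 : ℂ) 1, F z = c * outerFun u z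

lemma isScaledOuter_of_re_pos {F : ℂ → ℂ} (hF : DifferentiableOn ℂ F (Metric.ball 0 1))
    (hpos : ∀ z ∈ Metric.ball (0 : ℂ) 1, 0 < (F z).re) : IsScaledOuter F :=
  exists_eq_const_mul_outerFun_of_re_pos hF hpos

lemma IsScaledOuter.mul {F G : ℂ → ℂ} (hF : IsScaledOuter F) (hG : IsScaledOuter G) :
    IsScaledOuter (F * G) := by
  obtain ⟨c, hc, u, hu, h⟩ := hF
  obtain ⟨d, hd, v, hv, k⟩ := hG
  refine ⟨c * d, mul_ne_zero hc hd, u + v, hu.add hv, fun z hz => ?_⟩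
  rw [Pi.mul_apply, h z hz, k z hz, outerFun_add hu hv hz]
  ring

lemma isScaledOuter_const {c : ℂ} (hc : c ≠ 0) : IsScaledOuter fun _ => c :=
  ⟨c, hc, 0, circleIntegrable_const (0 : ℝ) 0 1, fun z _ => by
    simp [outerFun, Real.circleAverage_def]⟩

lemma IsScaledOuter.pow {F : ℂ → ℂ} (hF : IsScaledOuter F) (n : ℕ) : IsScaledOuter (F ^ n) := by
  induction n with
  | zero => exact isScaledOuter_const one_ne_zero
  | succ n ih => exact (pow_succ F n) ▸ ih.mul hF

/-- For `‖c‖` larger than the bound of `a`, the function `c - a` is outer up to a constant. -/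
lemma isScaledOuter_const_sub {a : ℂ → ℂ} (ha : DifferentiableOn ℂ a (Metric.ball 0 1)) {c : ℂ}
    (h : ∀ z ∈ Metric.ball (0 : ℂ) 1, ‖a z‖ < ‖c‖) : IsScaledOuter fun z => c - a z := by
  have hc : c ≠ 0 := norm_pos_iff.1
    ((norm_nonneg _).trans_lt (h 0 (Metric.mem_ball_self one_pos)))
  have key : IsScaledOuter fun z => 1 - a z / c := by
    refine isScaledOuter_of_re_pos ((ha.div_const c).const_sub 1) fun z hz => ?_
    have h1 : ‖a z / c‖ < 1 := by
      rw [norm_div, div_lt_one (norm_pos_iff.2 hc)]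
      exact h z hz
    rw [Complex.sub_re, Complex.one_re]
    linarith [Complex.re_le_norm (a z / c)]
  have := (isScaledOuter_const hc).mul key
  convert this using 1
  ext z
  simp only [Pi.mul_apply]
  field_simp

/-- Every function in `H^p` is dominated by a multiple of an outer function in `H^p` whose modulus
is at least `1`. -/
lemma MemHardy.exists_isScaledOuter {p : ℝ≥0∞} (hp : 0 < p) {h : ℂ → ℂ} (hh : MemHardy p h) :
    ∃ g, MemHardy p g ∧ IsScaledOuter g ∧
      ∀ z ∈ Metric.ball (0 : ℂ) 1, 1 ≤ ‖g z‖ ∧ ‖h z‖ ≤ ‖g z‖ := by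
  have h2 := hh.2
  by_cases hpt : p = ⊤
  · rw [if_pos hpt] at h2
    obtain ⟨C, hC⟩ := h2
    have hpos : 0 < max 1 C := lt_max_of_lt_left one_pos
    refine ⟨fun _ => (max 1 C : ℝ), memHardy_const p _,
      isScaledOuter_const (by exact_mod_cast hpos.ne'), fun z hz => ?_⟩
    rw [Complex.norm_real, Real.norm_of_nonneg hpos.le]
    exact ⟨le_max_left _ _, (hC z hz).trans (le_max_right _ _)⟩
  · rw [if_neg hpt] at h2
    obtain ⟨C, hC⟩ := h2
    obtain ⟨u, hu, hdom, hB⟩ :=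
      exists_norm_le_norm_outerFun (ENNReal.toReal_pos hp.ne' hpt) hh.1 hC
    refine ⟨outerFun u, ⟨differentiableOn_outerFun hu, ?_⟩,
      ⟨1, one_ne_zero, u, hu, fun z _ => (one_mul _).symm⟩, hdom⟩
    rw [if_neg hpt]
    exact hB

/-- The algebra of functions on `ℂ` whose restriction to the unit disk is bounded and
holomorphic. -/
def boundedHolomorphic : Subalgebra ℂ (ℂ → ℂ) where
  carrier := {a | DifferentiableOn ℂ a (Metric.ball 0 1) ∧
    ∃ C, ∀ z ∈ Metric.ball (0 : ℂ) 1, ‖a z‖ ≤ C}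
  mul_mem' := by
    rintro a b ⟨ha, C, hC⟩ ⟨hb, D, hD⟩
    refine ⟨ha.mul hb, C * D, fun z hz => ?_⟩
    rw [Pi.mul_apply, norm_mul]
    exact mul_le_mul (hC z hz) (hD z hz) (norm_nonneg _) ((norm_nonneg _).trans (hC z hz))
  add_mem' := by
    rintro a b ⟨ha, C, hC⟩ ⟨hb, D, hD⟩
    exact ⟨ha.add hb, C + D, fun z hz => (norm_add_le _ _).trans (add_le_add (hC z hz) (hD z hz))⟩
  algebraMap_mem' c := ⟨differentiableOn_const c, ‖c‖, fun _ _ => le_rfl⟩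

/-- A linear functional on `H^p` that is normalised and does not vanish on outer functions. -/
structure OuterNonvanishing (p : ℝ≥0∞) (L : (ℂ → ℂ) → ℂ) : Prop where
  map_add : ∀ F G, MemHardy p F → MemHardy p G → L (F + G) = L F + L G
  map_smul : ∀ (c : ℂ) (F), MemHardy p F → L (c • F) = c * L F
  congr : ∀ F G, Set.EqOn F G (Metric.ball 0 1) → L F = L G
  map_one : L 1 = 1
  ne_zero : ∀ F, MemHardy p F → IsScaledOuter F → L F ≠ 0

namespace OuterNonvanishing

variable {p : ℝ≥0∞} {L : (ℂ → ℂ) → ℂ}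

lemma map_mul_mul (hL : OuterNonvanishing p L) {g : ℂ → ℂ} (hg : MemHardy p g)
    (hgo : IsScaledOuter g) (a b : boundedHolomorphic) :
    L (a.1 * b.1 * g) * L g = L (a.1 * g) * L (b.1 * g) := by
  have hmem : ∀ a : boundedHolomorphic, MemHardy p (a.1 * g) := fun a =>
    hg.bounded_mul a.2.1 a.2.2.choose_spec
  have hg0 : L g ≠ 0 := hL.ne_zero g hg hgo
  let φ : boundedHolomorphic →ₗ[ℂ] ℂ :=
    { toFun := fun a => (L g)⁻¹ * L (a.1 * g)
      map_add' := fun a b => by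
        rw [Subalgebra.coe_add, add_mul, hL.map_add _ _ (hmem a) (hmem b), mul_add]
      map_smul' := fun c a => by
        rw [Subalgebra.coe_smul, smul_mul_assoc, hL.map_smul _ _ (hmem a), RingHom.id_apply,
          smul_eq_mul]
        ring }
  have hφ : ∀ a, φ a = (L g)⁻¹ * L (a.1 * g) := fun _ => rfl
  have hsq : ∀ a, φ (a ^ 2) = φ a ^ 2 := fun a => by
    obtain ⟨C, hC⟩ := a.2.2
    refine φ.map_sq_of_forall_map_sub_pow_ne_zero ?_ a C fun c hc n => ?_
    · rw [hφ, Subalgebra.coe_one, one_mul, inv_mul_cancel₀ hg0]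
    · rw [hφ]
      refine mul_ne_zero (inv_ne_zero hg0) (hL.ne_zero _ (hmem _) (IsScaledOuter.mul ?_ hgo))
      rw [Subalgebra.coe_pow]
      exact (isScaledOuter_const_sub a.2.1 fun z hz => (hC z hz).trans_lt hc).pow n
  have hmul : φ (a * b) = φ a * φ b := by
    have h1 := hsq (a + b)
    have h2 : (a + b) ^ 2 = a ^ 2 + (2 : ℂ) • (a * b) + b ^ 2 := by
      rw [ofNat_smul_eq_nsmul]
      simp only [nsmul_eq_mul]
      push_cast
      ring
    rw [h2, _root_.map_add, _root_.map_add, _root_.map_add, _root_.map_smul, hsq, hsq,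
      smul_eq_mul] at h1
    linear_combination h1 / 2
  rw [hφ, hφ, hφ, Subalgebra.coe_mul] at hmul
  field_simp at hmul
  linear_combination hmul

lemma norm_map_id_lt_one (hL : OuterNonvanishing p L) : ‖L id‖ < 1 := by
  have hid : MemHardy p id := memHardy_of_bounded p differentiableOn_id
    fun z hz => (mem_ball_zero_iff.1 hz).le
  by_contra! hle
  have hone : MemHardy p 1 := memHardy_const p 1
  have h2 : (fun z => L id - id z) = L id • (1 : ℂ → ℂ) + (-1 : ℂ) • id := by
    ext z
    simp [sub_eq_add_neg]
  have ho : IsScaledOuter (fun z => L id - id z) := isScaledOuter_const_sub differentiableOn_id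
    fun z hz => (mem_ball_zero_iff.1 hz).trans_le hle
  have hm : MemHardy p (fun z => L id - id z) :=
    memHardy_of_bounded p (differentiableOn_id.const_sub _) (C := ‖L id‖ + 1)
      fun z hz => (norm_sub_le _ _).trans (by
        have := (mem_ball_zero_iff.1 hz).le
        simpa using this)
  refine hL.ne_zero _ hm ho ?_
  rw [h2, hL.map_add _ _ (hone.const_smul _) (hid.const_smul _), hL.map_smul _ _ hone,
    hL.map_smul _ _ hid, hL.map_one]
  ring

lemma map_id_mul_of_isScaledOuter (hL : OuterNonvanishing p L) {g : ℂ → ℂ} (hg : MemHardy p g)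
    (hgo : IsScaledOuter g) (h1 : ∀ z ∈ Metric.ball (0 : ℂ) 1, 1 ≤ ‖g z‖) :
    L (id * g) = L id * L g := by
  have hne : ∀ z ∈ Metric.ball (0 : ℂ) 1, g z ≠ 0 := fun z hz =>
    norm_pos_iff.1 (one_pos.trans_le (h1 z hz))
  let a : boundedHolomorphic := ⟨id, differentiableOn_id, 1, fun z hz =>
    (mem_ball_zero_iff.1 hz).le⟩
  let b : boundedHolomorphic := ⟨g⁻¹, hg.1.inv hne, 1, fun z hz => by
    rw [Pi.inv_apply, norm_inv]
    exact inv_le_one_of_one_le₀ (h1 z hz)⟩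
  have h := hL.map_mul_mul hg hgo a b
  rw [hL.congr (a.1 * b.1 * g) id fun z hz => by simp [a, b, hne z hz],
    hL.congr (b.1 * g) 1 fun z hz => by simp [b, hne z hz], hL.map_one, mul_one] at h
  exact h.symm

lemma map_id_mul (hL : OuterNonvanishing p L) (hp : 0 < p) {h : ℂ → ℂ} (hh : MemHardy p h) :
    L (id * h) = L id * L h := by
  obtain ⟨g, hg, hgo, hgb⟩ := hh.exists_isScaledOuter hp
  have hne : ∀ z ∈ Metric.ball (0 : ℂ) 1, g z ≠ 0 := fun z hz =>
    norm_pos_iff.1 (one_pos.trans_le (hgb z hz).1)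
  have hid : ∀ {A}, MemHardy p A → MemHardy p (id * A) := fun hA =>
    hA.bounded_mul differentiableOn_id fun z hz => (mem_ball_zero_iff.1 hz).le
  have hk : MemHardy p (h + (2 : ℂ) • g) :=
    hg.of_norm_le (hh.1.add (hg.1.const_smul 2)) (zero_le_three (α := ℝ)) fun z hz => by
      refine (norm_add_le _ _).trans ?_
      simp only [Pi.smul_apply, norm_smul, Complex.norm_ofNat]
      linarith [(hgb z hz).2]
  have hr : ∀ z ∈ Metric.ball (0 : ℂ) 1, ‖h z / g z‖ ≤ 1 := fun z hz => by
    rw [norm_div, div_le_one (one_pos.trans_le (hgb z hz).1)]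
    exact (hgb z hz).2
  have hko : IsScaledOuter (h + (2 : ℂ) • g) := by
    have h1 : IsScaledOuter fun z => h z / g z + 2 :=
      isScaledOuter_of_re_pos ((hh.1.div hg.1 hne).add_const 2) fun z hz => by
        have := (abs_le.1 ((Complex.abs_re_le_norm _).trans (hr z hz))).1
        simp only [Complex.add_re, Complex.re_ofNat]
        linarith
    obtain ⟨c, hc, u, hu, h2⟩ := h1.mul hgo
    refine ⟨c, hc, u, hu, fun z hz => ?_⟩
    rw [← h2 z hz]
    simp [add_mul, hne z hz]
  have e1 := hL.map_id_mul_of_isScaledOuter hg hgo fun z hz => (hgb z hz).1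
  have e2 := hL.map_id_mul_of_isScaledOuter hk hko fun z hz => by
    have h3 := norm_sub_norm_le ((2 : ℂ) * g z) (-h z)
    rw [norm_mul, Complex.norm_ofNat, norm_neg, sub_neg_eq_add, add_comm] at h3
    simp only [Pi.add_apply, Pi.smul_apply, smul_eq_mul]
    linarith [(hgb z hz).1, (hgb z hz).2]
  rw [mul_add, mul_smul_comm, hL.map_add _ _ (hid hh) ((hid hg).const_smul 2),
    hL.map_smul _ _ (hid hg), hL.map_add _ _ hh (hg.const_smul 2), hL.map_smul _ _ hg, e1] at e2
  linear_combination e2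

end OuterNonvanishing

/-- The difference quotient of a function in `H^p` at a point of the disk is in `H^p`. -/
lemma MemHardy.dslope {p : ℝ≥0∞} {F : ℂ → ℂ} (hF : MemHardy p F) {w : ℂ}
    (hw : w ∈ Metric.ball (0 : ℂ) 1) : MemHardy p (dslope F w) := by
  have hd : DifferentiableOn ℂ (_root_.dslope F w) (Metric.ball 0 1) :=
    (Complex.differentiableOn_dslope (Metric.isOpen_ball.mem_nhds hw)).2 hF.1
  obtain ⟨δ, hδ, hsub⟩ := Metric.nhds_basis_closedBall.mem_iff.1 (Metric.isOpen_ball.mem_nhds hw)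
  obtain ⟨M, hM⟩ := (isCompact_closedBall w δ).exists_bound_of_continuousOn
    (hd.continuousOn.mono hsub)
  have hM0 : 0 ≤ M := (norm_nonneg _).trans (hM w (Metric.mem_closedBall_self hδ.le))
  have hK : 0 ≤ (1 + ‖F w‖) / δ := by positivity
  refine hF.of_norm_le hd (K := M + (1 + ‖F w‖) / δ) (by positivity) fun z hz => ?_
  by_cases hzδ : z ∈ Metric.closedBall w δ
  · refine (hM z hzδ).trans ?_
    nlinarith [norm_nonneg (F z), mul_nonneg hM0 (norm_nonneg (F z)),
      mul_nonneg hK (norm_nonneg (F z))]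
  · rw [Metric.mem_closedBall, dist_eq_norm, not_le] at hzδ
    have hzw : z ≠ w := fun h => by simp [h] at hzδ; linarith
    have h1 : ‖_root_.dslope F w z‖ ≤ (1 + ‖F w‖) / δ * (1 + ‖F z‖) := by
      rw [dslope_of_ne _ hzw, slope_def_field, norm_div, div_mul_eq_mul_div]
      refine div_le_div₀ (by positivity) ((norm_sub_le _ _).trans ?_) hδ hzδ.le
      nlinarith [mul_nonneg (norm_nonneg (F z)) (norm_nonneg (F w))]
    refine h1.trans (mul_le_mul_of_nonneg_right (by linarith) (by positivity))

/-- A normalised linear functional on `H^p` that does not vanish on outer functions is the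
evaluation at its value on the identity. -/
lemma OuterNonvanishing.map_eq {p : ℝ≥0∞} {L : (ℂ → ℂ) → ℂ} (hL : OuterNonvanishing p L)
    (hp : 0 < p) {F : ℂ → ℂ} (hF : MemHardy p F) : L F = F (L id) := by
  have hw : L id ∈ Metric.ball (0 : ℂ) 1 := mem_ball_zero_iff.2 hL.norm_map_id_lt_one
  have hh := hF.dslope hw
  have hone : MemHardy p 1 := memHardy_const p 1
  have heq : F + L id • dslope F (L id) = F (L id) • (1 : ℂ → ℂ) + id * dslope F (L id) := by
    ext z
    have := sub_smul_dslope F (L id) z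
    simp only [smul_eq_mul, Pi.add_apply, Pi.smul_apply, Pi.one_apply, Pi.mul_apply, id] at this ⊢
    linear_combination -this
  have h := congrArg L heq
  rw [hL.map_add _ _ hF (hh.const_smul _), hL.map_smul _ _ hh,
    hL.map_add _ _ (hone.const_smul _)
      (hh.bounded_mul differentiableOn_id fun z hz => (mem_ball_zero_iff.1 hz).le),
    hL.map_smul _ _ hone, hL.map_one, hL.map_id_mul hp hh] at h
  linear_combination h

/-- **GKZ theorem for Hardy spaces.** For `0 < p ≤ ∞`, a ℂ-linear functional `Λ` on
`H^p` (not assumed continuous) with `Λ 1 = 1` that is non-zero on every outer function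
in `H^p` is evaluation at some point `w` of the unit disk. -/
theorem gkz_hardy (p : ℝ≥0∞) (hp : 0 < p) (Λ : (unitDisk → ℂ) → ℂ)
    (hadd : ∀ f g : unitDisk → ℂ, f ∈ hardy p → g ∈ hardy p → Λ (f + g) = Λ f + Λ g)
    (hsmul : ∀ (c : ℂ) (f : unitDisk → ℂ), f ∈ hardy p → Λ (c • f) = c * Λ f)
    (h1 : Λ 1 = 1)
    (hout : ∀ g ∈ hardy p, IsOuter g → Λ g ≠ 0) :
    ∃ w : unitDisk, ∀ f ∈ hardy p, Λ f = f w := by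
  have hmem : ∀ {F}, MemHardy p F → (fun z : unitDisk => F z) ∈ hardy p := fun hF =>
    mem_hardy_iff.2 ⟨_, hF, rfl⟩
  have hL : OuterNonvanishing p fun F => Λ fun z => F z :=
    { map_add := fun F G hF hG => hadd _ _ (hmem hF) (hmem hG)
      map_smul := fun c F hF => hsmul c _ (hmem hF)
      congr := fun F G h => congrArg Λ (funext fun z => h z.2)
      map_one := h1
      ne_zero := fun F hF ⟨c, hc, u, hu, h⟩ => by
        have hF' : (fun z : unitDisk => F z) = c • fun z : unitDisk => outerFun u z :=
          funext fun z => h z z.2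
        have hu' : (fun z : unitDisk => outerFun u z) ∈ hardy p := by
          have h2 := hmem (hF.const_smul c⁻¹)
          convert h2 using 1
          ext z
          simp [h z z.2, hc]
        simp only [hF', hsmul c _ hu']
        exact mul_ne_zero hc (hout _ hu' (isOuter_outerFun hu)) }
  refine ⟨⟨_, mem_ball_zero_iff.2 hL.norm_map_id_lt_one⟩, fun f hf => ?_⟩
  obtain ⟨F, hF, rfl⟩ := mem_hardy_iff.1 hf
  exact hL.map_eq hp hF
end
end

section
/- Let 0 < p ≤ ∞ and let T : H^p → hol(𝔻) be a ℂ-linear map (not assumed continuous) such that (Tg)(z) ≠ 0 for every outer function g ∈ H^p and every z ∈ 𝔻. Then there exist holomorphic functions φ : 𝔻 → 𝔻 and ψ : 𝔻 → ℂ∖{0} such that Tf = ψ·(f∘φ) for all f ∈ H^p. -/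
open MeasureTheory
open scoped ENNReal

noncomputable section

open Metric Set Filter Topology Real

/-- The Poisson integral over the unit circle of a real function `u`. -/
def poissonIntegral (u : ℂ → ℝ) (w : ℂ) : ℝ :=
  circleAverage (fun ζ => poissonKernel 0 w ζ * u ζ) 0 1

/-- The Herglotz integral over the unit circle of a real function `u`. -/
def herglotzIntegral (u : ℂ → ℝ) (w : ℂ) : ℂ :=
  circleAverage (fun ζ => herglotzRieszKernel 0 w ζ • (u ζ : ℂ)) 0 1

lemma CircleIntegrable.ofReal {u : ℂ → ℝ} {c : ℂ} {R : ℝ} (hu : CircleIntegrable u c R) :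
    CircleIntegrable (fun ζ => (u ζ : ℂ)) c R := by
  simp only [CircleIntegrable, intervalIntegrable_iff] at hu ⊢
  exact Complex.ofRealCLM.integrable_comp hu

lemma re_herglotzIntegral {u : ℂ → ℝ} (hu : CircleIntegrable u 0 1) {w : ℂ}
    (hw : w ∈ ball (0 : ℂ) 1) : (herglotzIntegral u w).re = poissonIntegral u w := by
  rw [herglotzIntegral, re_circleAverage_herglotzRieszKernel_smul hu hw, poissonIntegral,
    poissonKernel_eq_re_herglotzRieszKernel]
  rfl

lemma differentiableOn_herglotzIntegral {u : ℂ → ℝ} (hu : CircleIntegrable u 0 1) :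
    DifferentiableOn ℂ (herglotzIntegral u) (ball 0 1) :=
  differentiableOn_circleAverage_herglotzRieszKernel_smul hu.ofReal

lemma herglotzIntegral_add {u v : ℂ → ℝ} (hu : CircleIntegrable u 0 1)
    (hv : CircleIntegrable v 0 1) {w : ℂ} (hw : w ∈ ball (0 : ℂ) 1) :
    herglotzIntegral (fun ζ => u ζ + v ζ) w = herglotzIntegral u w + herglotzIntegral v w := by
  have hK := continuousOn_herglotzRieszKernel_sphere hw
  rw [herglotzIntegral, herglotzIntegral, herglotzIntegral, ← circleAverage_add]
  · congr 1
    ext ζ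
    simp [mul_add]
  · exact hu.ofReal.continuousOn_smul hK
  · exact hv.ofReal.continuousOn_smul hK

lemma continuousOn_poissonKernel_sphere {w : ℂ} (hw : w ∈ ball (0 : ℂ) 1) :
    ContinuousOn (poissonKernel 0 w) (sphere 0 |1|) := by
  rw [poissonKernel_eq_re_herglotzRieszKernel]
  exact Complex.continuous_re.comp_continuousOn (continuousOn_herglotzRieszKernel_sphere hw)

lemma circleIntegrable_poissonKernel_mul {u : ℂ → ℝ} (hu : CircleIntegrable u 0 1) {w : ℂ}
    (hw : w ∈ ball (0 : ℂ) 1) : CircleIntegrable (fun ζ => poissonKernel 0 w ζ * u ζ) 0 1 :=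
  hu.continuousOn_smul (continuousOn_poissonKernel_sphere hw)

lemma poissonKernel_nonneg {w ζ : ℂ} (hw : w ∈ ball (0 : ℂ) 1) (hζ : ζ ∈ sphere (0 : ℂ) 1) :
    0 ≤ poissonKernel 0 w ζ := by
  rw [mem_ball_zero_iff] at hw
  rw [mem_sphere_zero_iff_norm] at hζ
  rw [poissonKernel_def, sub_zero, sub_zero, hζ]
  have := norm_nonneg w
  exact div_nonneg (by nlinarith) (by positivity)

lemma poissonKernel_le {w ζ : ℂ} (hw : w ∈ ball (0 : ℂ) 1) (hζ : ζ ∈ sphere (0 : ℂ) 1) :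
    poissonKernel 0 w ζ ≤ (1 + ‖w‖) / (1 - ‖w‖) := by
  rw [poissonKernel_eq_re_herglotzRieszKernel]
  simpa [herglotzRieszKernel_def] using re_herglotzRieszKernel_le hζ hw

lemma poissonIntegral_mono {u v : ℂ → ℝ} (hu : CircleIntegrable u 0 1)
    (hv : CircleIntegrable v 0 1) (h : ∀ ζ ∈ sphere (0 : ℂ) 1, u ζ ≤ v ζ) {w : ℂ}
    (hw : w ∈ ball (0 : ℂ) 1) : poissonIntegral u w ≤ poissonIntegral v w := by
  refine circleAverage_mono (circleIntegrable_poissonKernel_mul hu hw)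
    (circleIntegrable_poissonKernel_mul hv hw) fun ζ hζ => ?_
  rw [abs_one] at hζ
  exact mul_le_mul_of_nonneg_left (h ζ hζ) (poissonKernel_nonneg hw hζ)

lemma poissonIntegral_add {u v : ℂ → ℝ} (hu : CircleIntegrable u 0 1)
    (hv : CircleIntegrable v 0 1) {w : ℂ} (hw : w ∈ ball (0 : ℂ) 1) :
    poissonIntegral (fun ζ => u ζ + v ζ) w = poissonIntegral u w + poissonIntegral v w := by
  rw [poissonIntegral, poissonIntegral, poissonIntegral, ← circleAverage_add
    (circleIntegrable_poissonKernel_mul hu hw) (circleIntegrable_poissonKernel_mul hv hw)]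
  congr 1
  ext ζ
  simp [mul_add]

lemma poissonIntegral_const_mul (c : ℝ) (u : ℂ → ℝ) (w : ℂ) :
    poissonIntegral (fun ζ => c * u ζ) w = c * poissonIntegral u w := by
  rw [poissonIntegral, poissonIntegral, ← smul_eq_mul c, ← circleAverage_fun_smul]
  congr 1
  ext ζ
  simp only [smul_eq_mul]
  ring

lemma poissonIntegral_re {q : ℂ → ℂ} (hq : DiffContOnCl ℂ q (ball 0 1)) {w : ℂ}
    (hw : w ∈ ball (0 : ℂ) 1) : poissonIntegral (fun ζ => (q ζ).re) w = (q w).re := by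
  have hcont : ContinuousOn q (sphere 0 |1|) :=
    hq.2.mono (by rw [abs_one, closure_ball 0 one_ne_zero]; exact sphere_subset_closedBall)
  have hci : CircleIntegrable (poissonKernel 0 w • q) 0 1 :=
    ((continuousOn_poissonKernel_sphere hw).smul hcont).circleIntegrable'
  rw [← hq.circleAverage_poissonKernel_smul hw]
  refine Eq.trans ?_ (Complex.reCLM.circleAverage_comp_comm hci)
  rw [poissonIntegral]
  congr 1
  ext ζ
  simp

lemma poissonIntegral_const (c : ℝ) {w : ℂ} (hw : w ∈ ball (0 : ℂ) 1) :
    poissonIntegral (fun _ => c) w = c :=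
  poissonIntegral_re (q := fun _ => (c : ℂ)) diffContOnCl_const hw

lemma poissonIntegral_nonneg {u : ℂ → ℝ} (h : ∀ ζ ∈ sphere (0 : ℂ) 1, 0 ≤ u ζ) {w : ℂ}
    (hw : w ∈ ball (0 : ℂ) 1) : 0 ≤ poissonIntegral u w :=
  circleAverage_nonneg_of_nonneg fun ζ hζ => by
    rw [abs_one] at hζ
    exact mul_nonneg (poissonKernel_nonneg hw hζ) (h ζ hζ)

/-- The mean of a Poisson integral over a concentric circle is the mean of its boundary values. -/
lemma circleAverage_poissonIntegral {u : ℂ → ℝ} (hu : CircleIntegrable u 0 1) {r : ℝ}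
    (hr : r ∈ Ico (0 : ℝ) 1) :
    circleAverage (poissonIntegral u) 0 r = circleAverage u 0 1 := by
  have hd := differentiableOn_herglotzIntegral hu
  have hsub : closedBall (0 : ℂ) |r| ⊆ ball 0 1 := by
    rw [abs_of_nonneg hr.1]
    exact closedBall_subset_ball hr.2
  have hcont : ContinuousOn (herglotzIntegral u) (sphere 0 |r|) :=
    hd.continuousOn.mono (sphere_subset_closedBall.trans hsub)
  have h0 : (0 : ℂ) ∈ ball (0 : ℂ) 1 := by simp
  have h1 : circleAverage (herglotzIntegral u) 0 r = herglotzIntegral u 0 :=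
    (hd.diffContOnCl_ball hsub).circleAverage
  have h2 := Complex.reCLM.circleAverage_comp_comm hcont.circleIntegrable'
  simp only [Complex.reCLM_apply] at h2
  rw [h1, re_herglotzIntegral hu h0] at h2
  have h3 : circleAverage (Complex.reCLM ∘ herglotzIntegral u) 0 r
      = circleAverage (poissonIntegral u) 0 r :=
    circleAverage_congr_sphere fun w hw =>
      re_herglotzIntegral hu (hsub (sphere_subset_closedBall hw))
  rw [← h3, h2]
  refine circleAverage_congr_sphere fun ζ hζ => ?_
  rw [abs_one, mem_sphere_zero_iff_norm] at hζ
  simp [poissonKernel_def, hζ]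

/-- Continuous real functions on the unit circle are uniformly approximated by real parts of entire
functions. -/
lemma exists_differentiable_re_approx {v : ℂ → ℝ} (hv : ContinuousOn v (sphere 0 1)) {ε : ℝ}
    (hε : 0 < ε) :
    ∃ q : ℂ → ℂ, Differentiable ℂ q ∧ ∀ ζ ∈ sphere (0 : ℂ) 1, |(q ζ).re - v ζ| ≤ ε := by
  have : Fact (0 < 2 * π) := ⟨two_pi_pos⟩
  have hmem (x : AddCircle (2 * π)) : (AddCircle.toCircle x : ℂ) ∈ sphere (0 : ℂ) 1 :=
    mem_sphere_zero_iff_norm.2 (Circle.norm_coe _)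
  let V : C(AddCircle (2 * π), ℂ) :=
    ⟨fun x => (v (AddCircle.toCircle x : ℂ) : ℂ), Complex.continuous_ofReal.comp
      (hv.comp_continuous (continuous_subtype_val.comp AddCircle.continuous_toCircle) hmem)⟩
  have hV : V ∈ closure (Submodule.span ℂ (range (@fourier (2 * π))) : Set _) := by
    rw [← Submodule.topologicalClosure_coe, span_fourier_closure_eq_top]
    trivial
  obtain ⟨t, ht, hdist⟩ := Metric.mem_closure_iff.1 hV ε hε
  have hspan : ∃ q₁ q₂ : ℂ → ℂ, Differentiable ℂ q₁ ∧ Differentiable ℂ q₂ ∧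
      ∀ x, t x = q₁ (AddCircle.toCircle x : ℂ) +
        (starRingEnd ℂ) (q₂ (AddCircle.toCircle x : ℂ)) := by
    clear hdist
    induction ht using Submodule.span_induction with
    | mem t h =>
      obtain ⟨n, rfl⟩ := h
      obtain ⟨m, rfl | rfl⟩ := n.eq_nat_or_neg
      · refine ⟨fun z => z ^ m, fun _ => 0, by fun_prop, by fun_prop, fun x => ?_⟩
        simp [fourier_apply, AddCircle.toCircle_nsmul]
      · refine ⟨fun _ => 0, fun z => z ^ m, by fun_prop, by fun_prop, fun x => ?_⟩
        rw [fourier_neg, zero_add]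
        simp [fourier_apply, AddCircle.toCircle_nsmul]
    | zero => exact ⟨fun _ => 0, fun _ => 0, by fun_prop, by fun_prop, by simp⟩
    | add s t _ _ hs ht =>
      obtain ⟨a, b, ha, hb, h⟩ := hs
      obtain ⟨c, d, hc, hd, h'⟩ := ht
      refine ⟨a + c, b + d, ha.add hc, hb.add hd, fun x => ?_⟩
      simp only [ContinuousMap.add_apply, h, h', Pi.add_apply, map_add]
      ring
    | smul c t _ ht =>
      obtain ⟨a, b, ha, hb, h⟩ := ht
      refine ⟨fun z => c * a z, fun z => (starRingEnd ℂ) c * b z, ha.const_mul _,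
        hb.const_mul _, fun x => ?_⟩
      simp [h, mul_add]
  obtain ⟨q₁, q₂, h₁, h₂, h⟩ := hspan
  refine ⟨q₁ + q₂, h₁.add h₂, fun ζ hζ => ?_⟩
  obtain ⟨x, hx⟩ := (AddCircle.homeomorphCircle (T := 2 * π) two_pi_pos.ne').surjective
    ⟨ζ, hζ⟩
  have hx' : (AddCircle.toCircle x : ℂ) = ζ := by
    simpa [AddCircle.homeomorphCircle_apply] using congrArg Subtype.val hx
  have key : ‖(V - t) x‖ ≤ ε := ((V - t).norm_coe_le_norm x).trans (by
    rw [← dist_eq_norm]; exact hdist.le)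
  have hre : ((q₁ + q₂) ζ).re - v ζ = -((V - t) x).re := by
    simp [V, h, hx']
  rw [hre, abs_neg]
  exact (Complex.abs_re_le_norm _).trans key

/-- A holomorphic function whose modulus is at most `exp v` on the unit circle is dominated inside
by the exponential of the Poisson integral of `v`. -/
lemma norm_le_exp_poissonIntegral {f : ℂ → ℂ} (hf : DiffContOnCl ℂ f (ball 0 1)) {v : ℂ → ℝ}
    (hv : ContinuousOn v (sphere 0 1)) (h : ∀ ζ ∈ sphere (0 : ℂ) 1, ‖f ζ‖ ≤ Real.exp (v ζ))
    {w : ℂ} (hw : w ∈ ball (0 : ℂ) 1) : ‖f w‖ ≤ Real.exp (poissonIntegral v w) := by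
  have hvi : CircleIntegrable v 0 1 := hv.circleIntegrable zero_le_one
  have key (ε : ℝ) (hε : 0 < ε) : ‖f w‖ ≤ Real.exp (poissonIntegral v w + 2 * ε) := by
    obtain ⟨q, hq, hqv⟩ := exists_differentiable_re_approx hv hε
    have hd : DiffContOnCl ℂ (fun z => Complex.exp (-q z) * f z) (ball 0 1) :=
      (hq.neg.cexp.diffContOnCl).smul hf
    have hb : ‖Complex.exp (-q w) * f w‖ ≤ Real.exp ε := by
      refine Complex.norm_le_of_forall_mem_frontier_norm_le isBounded_ball hd (fun ζ hζ => ?_)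
        (subset_closure hw)
      rw [frontier_ball 0 one_ne_zero] at hζ
      rw [norm_mul, Complex.norm_exp, Complex.neg_re]
      calc Real.exp (-(q ζ).re) * ‖f ζ‖ ≤ Real.exp (-(q ζ).re) * Real.exp (v ζ) := by
            gcongr
            exact h ζ hζ
        _ ≤ Real.exp ε := by
            rw [← Real.exp_add]
            gcongr
            have := (abs_le.1 (hqv ζ hζ)).1
            linarith
    have hqw : (q w).re ≤ poissonIntegral v w + ε := by
      rw [← poissonIntegral_re hq.diffContOnCl hw]
      calc poissonIntegral (fun ζ => (q ζ).re) w ≤ poissonIntegral (fun ζ => v ζ + ε) w :=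
            poissonIntegral_mono
              ((Complex.continuous_re.comp hq.continuous).continuousOn.circleIntegrable')
              (hvi.add (circleIntegrable_const ε 0 1))
              (fun ζ hζ => sub_le_iff_le_add'.1 (abs_le.1 (hqv ζ hζ)).2) hw
        _ = poissonIntegral v w + ε := by
            rw [poissonIntegral_add hvi (circleIntegrable_const ε 0 1) hw,
              poissonIntegral_const ε hw]
    have hfw : ‖f w‖ = Real.exp (q w).re * ‖Complex.exp (-q w) * f w‖ := by
      rw [norm_mul, Complex.norm_exp, Complex.neg_re, ← mul_assoc, ← Real.exp_add]
      simp
    calc ‖f w‖ ≤ Real.exp (poissonIntegral v w + ε) * Real.exp ε := by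
          rw [hfw]
          gcongr
      _ = Real.exp (poissonIntegral v w + 2 * ε) := by
          rw [← Real.exp_add]
          ring_nf
  have hlim : Tendsto (fun ε : ℝ => Real.exp (poissonIntegral v w + 2 * ε)) (𝓝[>] 0)
      (𝓝 (Real.exp (poissonIntegral v w))) := by
    have : Continuous fun ε : ℝ => Real.exp (poissonIntegral v w + 2 * ε) := by fun_prop
    simpa using (this.tendsto 0).mono_left nhdsWithin_le_nhds
  exact ge_of_tendsto hlim (eventually_mem_nhdsWithin.mono fun ε hε => key ε hε)

/-- Jensen's inequality for the Poisson integral and the exponential. -/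
lemma exp_poissonIntegral_le {u : ℂ → ℝ} (hu : ContinuousOn u (sphere 0 1)) (p : ℝ) {w : ℂ}
    (hw : w ∈ ball (0 : ℂ) 1) : Real.exp (p * poissonIntegral u w) ≤
      poissonIntegral (fun ζ => Real.exp (p * u ζ)) w := by
  have hui : CircleIntegrable u 0 1 := hu.circleIntegrable zero_le_one
  have hei : CircleIntegrable (fun ζ => Real.exp (p * u ζ)) 0 1 :=
    ContinuousOn.circleIntegrable zero_le_one (by fun_prop)
  set x := poissonIntegral u w with hx
  have hlin : CircleIntegrable (fun ζ => Real.exp (p * x) * p * u ζ) 0 1 := hui.const_mul _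
  calc Real.exp (p * x)
      = Real.exp (p * x) * p * x + Real.exp (p * x) * (1 - p * x) := by ring
    _ = poissonIntegral
        (fun ζ => Real.exp (p * x) * p * u ζ + Real.exp (p * x) * (1 - p * x)) w := by
      rw [poissonIntegral_add hlin (circleIntegrable_const _ 0 1) hw, poissonIntegral_const _ hw,
        poissonIntegral_const_mul]
    _ ≤ _ := by
      refine poissonIntegral_mono (hlin.add (circleIntegrable_const _ 0 1)) hei (fun ζ _ => ?_) hw
      have := Real.add_one_le_exp (p * u ζ - p * x)
      calc Real.exp (p * x) * p * u ζ + Real.exp (p * x) * (1 - p * x)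
          = Real.exp (p * x) * (p * u ζ - p * x + 1) := by ring
        _ ≤ Real.exp (p * x) * Real.exp (p * u ζ - p * x) := by gcongr
        _ = Real.exp (p * u ζ) := by rw [← Real.exp_add]; ring_nf

/-- Arc length on the unit circle, as a measure on `ℂ`. -/
def arcLength : Measure ℂ := (volume.restrict (Ioc 0 (2 * π))).map (circleMap 0 1)

instance : IsFiniteMeasure arcLength := by
  unfold arcLength
  infer_instance

lemma ae_mem_sphere_arcLength : ∀ᵐ ζ ∂arcLength, ζ ∈ sphere (0 : ℂ) 1 := by
  refine (ae_map_iff (p := fun ζ => ζ ∈ sphere (0 : ℂ) 1)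
    (measurable_circleMap 0 1).aemeasurable isClosed_sphere.measurableSet).2 ?_
  exact ae_of_all _ fun θ => circleMap_mem_sphere 0 zero_le_one θ

lemma ContinuousOn.aestronglyMeasurable_arcLength {f : ℂ → ℝ} (hf : ContinuousOn f (sphere 0 1)) :
    AEStronglyMeasurable f arcLength := by
  rw [← Measure.restrict_eq_self_of_ae_mem ae_mem_sphere_arcLength]
  exact hf.aestronglyMeasurable isClosed_sphere.measurableSet

lemma ContinuousOn.memLp_arcLength {f : ℂ → ℝ} (hf : ContinuousOn f (sphere 0 1)) (p : ℝ≥0∞) :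
    MemLp f p arcLength := by
  obtain ⟨M, hM⟩ := (isCompact_sphere (0 : ℂ) 1).exists_bound_of_continuousOn hf
  exact MemLp.of_bound hf.aestronglyMeasurable_arcLength M
    (ae_mem_sphere_arcLength.mono fun ζ hζ => hM ζ hζ)

lemma integral_arcLength {f : ℂ → ℝ} (hf : AEStronglyMeasurable f arcLength) :
    ∫ ζ, f ζ ∂arcLength = 2 * π * circleAverage f 0 1 := by
  rw [circleAverage_def, smul_eq_mul, mul_inv_cancel_left₀ two_pi_pos.ne',
    intervalIntegral.integral_of_le two_pi_pos.le, arcLength,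
    integral_map (measurable_circleMap 0 1).aemeasurable hf]

lemma circleIntegrable_of_integrable_arcLength {f : ℂ → ℝ} (hf : Integrable f arcLength) :
    CircleIntegrable f 0 1 := by
  rw [CircleIntegrable, intervalIntegrable_iff, uIoc_of_le two_pi_pos.le]
  exact hf.comp_measurable (measurable_circleMap 0 1)

/-- A sequence of continuous functions bounded in `L²` of the circle has a subsequence whose
Poisson integrals converge pointwise to a Poisson integral. -/
lemma exists_subseq_tendsto_poissonIntegral {u : ℕ → ℂ → ℝ}
    (hu : ∀ n, ContinuousOn (u n) (sphere 0 1)) {C : ℝ}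
    (hC : ∀ n, circleAverage (fun ζ => u n ζ ^ 2) 0 1 ≤ C) :
    ∃ (φ : ℕ → ℕ) (v : ℂ → ℝ), StrictMono φ ∧ CircleIntegrable v 0 1 ∧
      ∀ w ∈ ball (0 : ℂ) 1,
        Tendsto (fun n => poissonIntegral (u (φ n)) w) atTop (𝓝 (poissonIntegral v w)) := by
  have : Fact ((2 : ℝ≥0∞) ≠ ∞) := ⟨by simp⟩
  let U (n : ℕ) : Lp ℝ 2 arcLength := ((hu n).memLp_arcLength 2).toLp (u n)
  have hUu (n : ℕ) : U n =ᵐ[arcLength] u n := MemLp.coeFn_toLp _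
  have hnorm (n : ℕ) : ‖U n‖ ≤ √(2 * π * C) := by
    refine Real.le_sqrt_of_sq_le ?_
    rw [← real_inner_self_eq_norm_sq, L2.inner_def]
    calc ∫ ζ, inner ℝ (U n ζ) (U n ζ) ∂arcLength = ∫ ζ, u n ζ ^ 2 ∂arcLength :=
          integral_congr_ae ((hUu n).mono fun ζ hζ => by simp [hζ])
      _ = 2 * π * circleAverage (fun ζ => u n ζ ^ 2) 0 1 :=
          integral_arcLength ((hu n).pow 2).aestronglyMeasurable_arcLength
      _ ≤ 2 * π * C := by
          gcongr
          exact hC n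
  let Φ := InnerProductSpace.toDual ℝ (Lp ℝ 2 arcLength)
  obtain ⟨ℓ, -, φ, hφ, hlim⟩ := WeakDual.isSeqCompact_closedBall ℝ (Lp ℝ 2 arcLength) 0
    √(2 * π * C) (x := fun n => StrongDual.toWeakDual (Φ (U n))) (fun n => by
      simpa [Φ] using hnorm n)
  let V : Lp ℝ 2 arcLength := Φ.symm (WeakDual.toStrongDual ℓ)
  have hVint : Integrable V arcLength := (Lp.memLp V).integrable (by norm_num)
  refine ⟨φ, V, hφ, circleIntegrable_of_integrable_arcLength hVint, fun w hw => ?_⟩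
  have hK : ContinuousOn (poissonKernel 0 w) (sphere 0 1) := by
    simpa using continuousOn_poissonKernel_sphere hw
  let K : Lp ℝ 2 arcLength := (hK.memLp_arcLength 2).toLp _
  have hKK : K =ᵐ[arcLength] poissonKernel 0 w := MemLp.coeFn_toLp _
  have hinner (W : Lp ℝ 2 arcLength) (v : ℂ → ℝ) (hWv : W =ᵐ[arcLength] v) :
      inner ℝ W K = 2 * π * poissonIntegral v w := by
    rw [L2.inner_def, poissonIntegral, ← integral_arcLength]
    · refine integral_congr_ae ?_
      filter_upwards [hWv, hKK] with ζ h1 h2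
      simp [h1, h2]
    · exact hK.aestronglyMeasurable_arcLength.mul
        ((Lp.aestronglyMeasurable W).congr hWv)
  have h1 : Tendsto (fun n => inner ℝ (U (φ n)) K) atTop (𝓝 (inner ℝ V K)) := by
    have := ((WeakDual.eval_continuous K).tendsto ℓ).comp hlim
    have hV : ℓ K = inner ℝ V K := by
      rw [← InnerProductSpace.toDual_apply_apply (𝕜 := ℝ)]
      simp [V, Φ]
    rw [hV] at this
    exact this
  have h2 : Tendsto (fun n => (2 * π)⁻¹ * inner ℝ (U (φ n)) K) atTop
      (𝓝 ((2 * π)⁻¹ * inner ℝ V K)) := h1.const_mul _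
  rw [hinner V V (ae_eq_refl _), inv_mul_cancel_left₀ two_pi_pos.ne'] at h2
  refine h2.congr fun n => ?_
  rw [hinner _ _ (hUu (φ n)), inv_mul_cancel_left₀ two_pi_pos.ne']

lemma circleAverage_comp_mul (f : ℂ → ℝ) (r : ℝ) :
    circleAverage (fun ζ => f (r * ζ)) 0 1 = circleAverage f 0 r := by
  rw [circleAverage_eq_circleAverage_zero_one (f := f)]
  simp

/-- A sequence of radii increasing to `1`. -/
def radius (n : ℕ) : ℝ := 1 - 1 / ((n : ℝ) + 1)

lemma radius_mem (n : ℕ) : radius n ∈ Ico (0 : ℝ) 1 := by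
  have h : (0 : ℝ) < (n : ℝ) + 1 := by positivity
  have h1 : 1 / ((n : ℝ) + 1) ≤ 1 := by
    rw [div_le_one h]
    linarith [n.cast_nonneg (α := ℝ)]
  exact ⟨by unfold radius; linarith, by unfold radius; linarith [one_div_pos.2 h]⟩

lemma tendsto_radius : Tendsto radius atTop (𝓝 1) := by
  have := (tendsto_one_div_add_atTop_nhds_zero_nat (𝕜 := ℝ)).const_sub 1
  rwa [sub_zero] at this

lemma radius_mul_mem_ball (n : ℕ) {z : ℂ} (hz : z ∈ closedBall (0 : ℂ) 1) :
    (radius n : ℂ) * z ∈ ball (0 : ℂ) 1 := by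
  have h := radius_mem n
  rw [mem_closedBall_zero_iff] at hz
  rw [mem_ball_zero_iff, norm_mul, Complex.norm_real, norm_of_nonneg h.1]
  nlinarith [h.1, h.2, norm_nonneg z]

lemma diffContOnCl_comp_radius_mul {f : ℂ → ℂ} (hf : DifferentiableOn ℂ f (ball 0 1)) (n : ℕ) :
    DiffContOnCl ℂ (fun z => f (radius n * z)) (ball 0 1) := by
  apply DifferentiableOn.diffContOnCl
  rw [closure_ball 0 one_ne_zero]
  exact hf.comp (by fun_prop) fun z hz => radius_mul_mem_ball n hz

lemma continuousOn_comp_radius_mul {f : ℂ → ℂ} (hf : DifferentiableOn ℂ f (ball 0 1)) (n : ℕ) :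
    ContinuousOn (fun z => f (radius n * z)) (sphere 0 1) :=
  hf.continuousOn.comp (by fun_prop)
    fun _ hz => radius_mul_mem_ball n (sphere_subset_closedBall hz)

lemma tendsto_comp_radius_mul {f : ℂ → ℂ} (hf : DifferentiableOn ℂ f (ball 0 1)) {w : ℂ}
    (hw : w ∈ ball (0 : ℂ) 1) :
    Tendsto (fun n => f (radius n * w)) atTop (𝓝 (f w)) := by
  have hc : ContinuousAt f w := (hf.continuousOn).continuousAt (isOpen_ball.mem_nhds hw)
  refine hc.tendsto.comp ?_
  have : Tendsto (fun n => (radius n : ℂ)) atTop (𝓝 ((1 : ℝ) : ℂ)) :=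
    (Complex.continuous_ofReal.tendsto 1).comp tendsto_radius
  simpa using this.mul_const w

/-- A holomorphic function on the disk whose real part is bounded in `L²` is, up to an additive
constant, a Herglotz integral. -/
lemma exists_herglotzIntegral_add_const {a : ℂ → ℂ} (ha : DifferentiableOn ℂ a (ball 0 1)) {C : ℝ}
    (hC : ∀ r ∈ Ico (0 : ℝ) 1, circleAverage (fun ζ => (a ζ).re ^ 2) 0 r ≤ C) :
    ∃ (u : ℂ → ℝ) (c : ℂ), CircleIntegrable u 0 1 ∧
      ∀ w ∈ ball (0 : ℂ) 1, a w = herglotzIntegral u w + c := by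
  obtain ⟨φ, u, hφ, hu, hlim⟩ :=
    exists_subseq_tendsto_poissonIntegral (u := fun n ζ => (a (radius n * ζ)).re) (C := C)
      (fun n => Complex.continuous_re.comp_continuousOn (continuousOn_comp_radius_mul ha n))
      (fun n => (circleAverage_comp_mul (fun ζ => (a ζ).re ^ 2) (radius n)).trans_le
        (hC _ (radius_mem n)))
  have hre (w : ℂ) (hw : w ∈ ball (0 : ℂ) 1) : (a w).re = (herglotzIntegral u w).re := by
    rw [re_herglotzIntegral hu hw]
    refine tendsto_nhds_unique ?_ (hlim w hw)
    refine Tendsto.congr (fun n =>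
      (poissonIntegral_re (diffContOnCl_comp_radius_mul ha (φ n)) hw).symm) ?_
    exact (Complex.continuous_re.tendsto _).comp
      ((tendsto_comp_radius_mul ha hw).comp hφ.tendsto_atTop)
  have hd : DifferentiableOn ℂ (fun w => a w - herglotzIntegral u w) (ball 0 1) :=
    ha.sub (differentiableOn_herglotzIntegral hu)
  have h0 : (0 : ℂ) ∈ ball (0 : ℂ) 1 := by simp
  have hconst := (hd.analyticOnNhd isOpen_ball).eq_const_of_re_eq_const (c₀ := 0)
    (fun w hw => by simp [hre w hw]) isOpen_ball
    ⟨⟨0, h0⟩, (convex_ball (0 : ℂ) 1).isPreconnected⟩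
  obtain ⟨c, hc⟩ := hconst
  refine ⟨u, c, hu, fun w hw => ?_⟩
  rw [← hc w hw]
  ring

lemma continuousOn_poissonIntegral {u : ℂ → ℝ} (hu : CircleIntegrable u 0 1) :
    ContinuousOn (poissonIntegral u) (ball 0 1) :=
  (Complex.continuous_re.comp_continuousOn
    (differentiableOn_herglotzIntegral hu).continuousOn).congr
    fun _ hw => (re_herglotzIntegral hu hw).symm

lemma circleMap_mem_ball {r : ℝ} (hr : r ∈ Ico (0 : ℝ) 1) (θ : ℝ) :
    circleMap 0 r θ ∈ ball (0 : ℂ) 1 := by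
  simpa [abs_of_nonneg hr.1] using hr.2

lemma sphere_subset_unit_ball {r : ℝ} (hr : r ∈ Ico (0 : ℝ) 1) :
    sphere (0 : ℂ) |r| ⊆ ball 0 1 := by
  rw [abs_of_nonneg hr.1]
  exact sphere_subset_closedBall.trans (closedBall_subset_ball hr.2)

lemma exp_mul_posLog (p : ℝ) {x : ℝ} (hx : 0 ≤ x) :
    Real.exp (p * log⁺ x) ≤ 1 + x ^ p := by
  have hxp : 0 ≤ x ^ p := by positivity
  rcases le_total x 1 with h | h
  · rw [(posLog_eq_zero_iff x).2 (by rwa [abs_of_nonneg hx])]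
    simpa using hxp
  · rw [posLog_eq_log (by rwa [abs_of_nonneg hx]), mul_comm,
      ← rpow_def_of_pos (zero_lt_one.trans_le h)]
    linarith

lemma le_exp_posLog {x : ℝ} (hx : 0 ≤ x) : x ≤ Real.exp (log⁺ x) := by
  rcases hx.eq_or_lt with rfl | h
  · positivity
  · exact (Real.le_exp_log x).trans (Real.exp_le_exp.2 (le_max_right _ _))

/-- A function of Hardy class `p` is dominated by the modulus of an outer function of Hardy
class `p` which is bounded below by `1`. -/
lemma exists_norm_le_exp_poissonIntegral {f : ℂ → ℂ} (hf : DifferentiableOn ℂ f (ball 0 1))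
    {p : ℝ} (hp : 0 < p) {C : ℝ}
    (hC : ∀ r ∈ Ico (0 : ℝ) 1, circleAverage (fun z => ‖f z‖ ^ p) 0 r ≤ C) :
    ∃ u : ℂ → ℝ, CircleIntegrable u 0 1 ∧
      (∀ w ∈ ball (0 : ℂ) 1, 0 ≤ poissonIntegral u w ∧ ‖f w‖ ≤ Real.exp (poissonIntegral u w)) ∧
      ∀ r ∈ Ico (0 : ℝ) 1,
        circleAverage (fun w => Real.exp (p * poissonIntegral u w)) 0 r ≤ 1 + C := by
  let u (n : ℕ) (ζ : ℂ) : ℝ := log⁺ ‖f (radius n * ζ)‖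
  have hu (n : ℕ) : ContinuousOn (u n) (sphere 0 1) :=
    continuous_posLog.comp_continuousOn (continuousOn_comp_radius_mul hf n).norm
  have he (n : ℕ) : ContinuousOn (fun ζ => Real.exp (p * u n ζ)) (sphere 0 1) := by
    have := hu n
    fun_prop
  have hexp (n : ℕ) : circleAverage (fun ζ => Real.exp (p * u n ζ)) 0 1 ≤ 1 + C := by
    have hfp : CircleIntegrable (fun ζ => ‖f (radius n * ζ)‖ ^ p) 0 1 :=
      ContinuousOn.circleIntegrable zero_le_one
        ((continuousOn_comp_radius_mul hf n).norm.rpow_const fun _ _ => Or.inr hp.le)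
    calc circleAverage (fun ζ => Real.exp (p * u n ζ)) 0 1
        ≤ circleAverage ((fun _ => (1 : ℝ)) + fun ζ => ‖f (radius n * ζ)‖ ^ p) 0 1 :=
          circleAverage_mono ((he n).circleIntegrable zero_le_one)
            ((circleIntegrable_const _ _ _).add hfp)
            fun ζ _ => exp_mul_posLog p (norm_nonneg _)
      _ = 1 + circleAverage (fun z => ‖f z‖ ^ p) 0 (radius n) := by
          rw [circleAverage_add (circleIntegrable_const _ _ _) hfp, circleAverage_const,
            circleAverage_comp_mul (fun z => ‖f z‖ ^ p)]
      _ ≤ 1 + C := by gcongr; exact hC _ (radius_mem n)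
  have hsq (n : ℕ) : circleAverage (fun ζ => u n ζ ^ 2) 0 1 ≤ (2 / p ^ 2) * (1 + C) := by
    calc circleAverage (fun ζ => u n ζ ^ 2) 0 1
        ≤ circleAverage (fun ζ => (2 / p ^ 2) • Real.exp (p * u n ζ)) 0 1 := by
          refine circleAverage_mono (((hu n).pow 2).circleIntegrable zero_le_one)
            (((he n).circleIntegrable zero_le_one).const_mul _) fun ζ _ => ?_
          have h0 : 0 ≤ u n ζ := posLog_nonneg
          have := Real.quadratic_le_exp_of_nonneg (mul_nonneg hp.le h0)
          rw [smul_eq_mul, div_mul_eq_mul_div, le_div_iff₀ (by positivity)]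
          nlinarith [mul_nonneg hp.le h0]
      _ = (2 / p ^ 2) * circleAverage (fun ζ => Real.exp (p * u n ζ)) 0 1 := by
          rw [circleAverage_fun_smul, smul_eq_mul]
      _ ≤ (2 / p ^ 2) * (1 + C) := by gcongr; exact hexp n
  obtain ⟨φ, v, hφ, hv, hlim⟩ := exists_subseq_tendsto_poissonIntegral hu hsq
  refine ⟨v, hv, fun w hw => ⟨?_, ?_⟩, fun r hr => ?_⟩
  · exact ge_of_tendsto' (hlim w hw) fun n =>
      poissonIntegral_nonneg (fun _ _ => posLog_nonneg) hw
  · refine le_of_tendsto_of_tendsto'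
      ((tendsto_comp_radius_mul hf hw).norm.comp hφ.tendsto_atTop)
      ((Real.continuous_exp.tendsto _).comp (hlim w hw)) fun n => ?_
    exact norm_le_exp_poissonIntegral (diffContOnCl_comp_radius_mul hf (φ n)) (hu (φ n))
      (fun ζ _ => le_exp_posLog (norm_nonneg _)) hw
  · have hle (n : ℕ) (w : ℂ) (hw : w ∈ ball (0 : ℂ) 1) :
        Real.exp (p * poissonIntegral (u n) w) ≤
          poissonIntegral (fun ζ => Real.exp (p * u n ζ)) w :=
      exp_poissonIntegral_le (hu n) p hw
    have hcont {x : ℂ → ℝ} (hx : CircleIntegrable x 0 1) :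
        ContinuousOn (poissonIntegral x) (sphere 0 |r|) :=
      (continuousOn_poissonIntegral hx).mono (sphere_subset_unit_ball hr)
    have hui (n : ℕ) : CircleIntegrable (u n) 0 1 := (hu n).circleIntegrable zero_le_one
    have hei (n : ℕ) := (he n).circleIntegrable zero_le_one
    have hcont' (n : ℕ) :
        ContinuousOn (fun w => Real.exp (p * poissonIntegral (u n) w)) (sphere 0 |r|) := by
      have := hcont (hui n)
      fun_prop
    have hbound (n : ℕ) :
        circleAverage (fun w => Real.exp (p * poissonIntegral (u n) w)) 0 r ≤ 1 + C :=
      calc _ ≤ circleAverage (poissonIntegral fun ζ => Real.exp (p * u n ζ)) 0 r :=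
            circleAverage_mono (hcont' n).circleIntegrable'
              (hcont (hei n)).circleIntegrable'
              fun w hw => hle n w (sphere_subset_unit_ball hr hw)
        _ ≤ 1 + C := by
            rw [circleAverage_poissonIntegral (hei n) hr]
            exact hexp n
    refine le_of_tendsto (x := atTop) (f := fun n : ℕ =>
      circleAverage (fun w => Real.exp (p * poissonIntegral (u (φ n)) w)) 0 r) ?_
      (Eventually.of_forall fun n => hbound (φ n))
    simp only [circleAverage_def]
    refine Tendsto.const_smul ?_ _
    refine intervalIntegral.tendsto_integral_filter_of_dominated_convergence
      (fun _ => (1 + r) / (1 - r) * (1 + C)) (Eventually.of_forall fun n => ?_)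
      (Eventually.of_forall fun n => ae_of_all _ fun θ _ => ?_)
      intervalIntegrable_const (ae_of_all _ fun θ _ => ?_)
    · exact ((hcont' (φ n)).comp_continuous (continuous_circleMap 0 r)
        (circleMap_mem_sphere' 0 r)).aestronglyMeasurable
    · have hw := circleMap_mem_ball hr θ
      rw [Real.norm_of_nonneg (Real.exp_nonneg _)]
      refine (hle (φ n) _ hw).trans ?_
      have hK : (1 + ‖circleMap 0 r θ‖) / (1 - ‖circleMap 0 r θ‖) = (1 + r) / (1 - r) := by
        simp [abs_of_nonneg hr.1]
      have hr1 : 0 ≤ (1 + r) / (1 - r) := div_nonneg (by linarith [hr.1]) (by linarith [hr.2])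
      calc poissonIntegral (fun ζ => Real.exp (p * u (φ n) ζ)) (circleMap 0 r θ)
          ≤ circleAverage (fun ζ => ((1 + r) / (1 - r)) • Real.exp (p * u (φ n) ζ)) 0 1 := by
            refine circleAverage_mono (circleIntegrable_poissonKernel_mul (hei _) hw)
              ((hei _).const_mul _) fun ζ hζ => ?_
            rw [abs_one] at hζ
            rw [smul_eq_mul, ← hK]
            gcongr
            exact poissonKernel_le hw hζ
        _ ≤ (1 + r) / (1 - r) * (1 + C) := by
            rw [circleAverage_fun_smul, smul_eq_mul]
            gcongr
            exact hexp _
    · exact (Real.continuous_exp.tendsto _).comp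
        ((hlim _ (circleMap_mem_ball hr θ)).const_mul p)

lemma Multiset.sum_sq_eq {R : Type*} [CommRing R] (s : Multiset R) :
    s.sum ^ 2 = (s.map (· ^ 2)).sum + 2 * s.esymm 2 := by
  induction s using Multiset.induction_on with
  | empty => simp [Multiset.esymm, Multiset.powersetCard_zero_right 1]
  | cons a s ih =>
    have h : (a ::ₘ s).esymm 2 = s.esymm 2 + a * s.sum := by
      simp [Multiset.esymm, Multiset.powersetCard_cons, Multiset.powersetCard_one,
        Multiset.sum_map_mul_left (f := fun x => x)]
    rw [Multiset.sum_cons, Multiset.map_cons, Multiset.sum_cons, h, add_sq, ih]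
    ring

lemma Multiset.norm_sum_map_sq_le (s : Multiset ℂ) {N : ℝ} (h : ∀ r ∈ s, ‖r‖ ≤ N) :
    ‖(s.map (· ^ 2)).sum‖ ≤ Multiset.card s * N ^ 2 := by
  induction s using Multiset.induction_on with
  | empty => simp
  | cons a s ih =>
    rw [Multiset.map_cons, Multiset.sum_cons, Multiset.card_cons]
    have h1 := ih fun r hr => h r (Multiset.mem_cons_of_mem hr)
    have h2 := h a (Multiset.mem_cons_self a s)
    have h3 : ‖a ^ 2‖ ≤ N ^ 2 := by
      rw [norm_pow]
      gcongr
    push_cast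
    linarith [norm_add_le (a ^ 2) (s.map (· ^ 2)).sum]

/-- A Gleason–Kahane–Żelazko type theorem: a unital linear functional that does not vanish on
the powers of `c - a` for large scalars `c` is multiplicative. -/
theorem map_mul_of_map_sub_pow_ne_zero {A : Type*} [CommRing A] [Algebra ℂ A] (χ : A →ₗ[ℂ] ℂ)
    (h1 : χ 1 = 1)
    (h : ∀ a : A, ∃ N : ℝ, ∀ (c : ℂ) (n : ℕ), N < ‖c‖ → χ ((algebraMap ℂ A c - a) ^ n) ≠ 0)
    (a b : A) : χ (a * b) = χ a * χ b := by
  have hsq (a : A) : χ (a ^ 2) = χ a ^ 2 := by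
    obtain ⟨N, hN⟩ := h a
    set D := χ a ^ 2 - χ (a ^ 2) with hD
    have key (m : ℕ) : (m : ℝ) * ‖D‖ ≤ N ^ 2 + ‖χ (a ^ 2)‖ := by
      set n := m + 2 with hn
      let coef (j : ℕ) : ℂ := χ ((-a) ^ (n - j)) * n.choose j
      let P : Polynomial ℂ := ∑ j ∈ Finset.range (n + 1), Polynomial.monomial j (coef j)
      have hcoeff (j : ℕ) : P.coeff j = if j < n + 1 then coef j else 0 := by
        simp [P, Polynomial.coeff_monomial]
      have hdeg : P.natDegree = n := by
        refine Polynomial.natDegree_eq_of_le_of_coeff_ne_zero ?_ ?_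
        · rw [Polynomial.natDegree_le_iff_coeff_eq_zero]
          intro j hj
          rw [hcoeff, if_neg (by omega)]
        · simp [hcoeff, coef, h1]
      have hlead : P.leadingCoeff = 1 := by
        simp [Polynomial.leadingCoeff, hdeg, hcoeff, coef, h1]
      have heval (c : ℂ) : P.eval c = χ ((algebraMap ℂ A c - a) ^ n) := by
        rw [sub_eq_add_neg, add_pow, map_sum]
        simp only [P, Polynomial.eval_finsetSum, Polynomial.eval_monomial, coef]
        refine Finset.sum_congr rfl fun j _ => ?_
        rw [← map_pow, ← Algebra.smul_def, smul_mul_assoc, map_smul, smul_eq_mul,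
          mul_comm _ (n.choose j : A), ← nsmul_eq_mul, map_nsmul, nsmul_eq_mul]
        ring
      have hcard : Multiset.card P.roots = P.natDegree :=
        Polynomial.splits_iff_card_roots.1 (IsAlgClosed.splits P)
      have hroots (r : ℂ) (hr : r ∈ P.roots) : ‖r‖ ≤ N := by
        by_contra! hlt
        exact hN r n hlt ((heval r).symm.trans (Polynomial.isRoot_of_mem_roots hr))
      have e1 := Polynomial.coeff_eq_esymm_roots_of_card hcard (k := n - 1) (by omega)
      have e2 := Polynomial.coeff_eq_esymm_roots_of_card hcard (k := n - 2) (by omega)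
      rw [hcoeff, if_pos (by omega), hdeg, hlead] at e1 e2
      have hn1 : n - (n - 1) = 1 := by omega
      have hn2 : n - (n - 2) = 2 := by omega
      have hs1 : P.roots.sum = n * χ a := by
        have : P.roots.esymm 1 = P.roots.sum := by
          simp [Multiset.esymm, Multiset.powersetCard_one]
        simp only [coef, hn1, this, pow_one, map_neg,
          Nat.choose_symm (show 1 ≤ n by omega), Nat.choose_one_right] at e1
        linear_combination e1
      have hs2 : 2 * P.roots.esymm 2 = n * (n - 1) * χ (a ^ 2) := by
        simp only [coef, hn2, neg_sq, Nat.choose_symm (show 2 ≤ n by omega),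
          Nat.cast_choose_two] at e2
        linear_combination (-2) * e2
      have hnorm := P.roots.norm_sum_map_sq_le hroots
      have hid : (P.roots.map (· ^ 2)).sum = n * (n * D + χ (a ^ 2)) := by
        have := P.roots.sum_sq_eq
        rw [hs1, hs2] at this
        rw [hD]
        linear_combination -this
      rw [hid, hcard, hdeg, norm_mul, Complex.norm_natCast] at hnorm
      have hle := le_of_mul_le_mul_left hnorm (by positivity)
      have h3 : (n : ℝ) * ‖D‖ ≤ ‖n * D + χ (a ^ 2)‖ + ‖χ (a ^ 2)‖ := by
        rw [← Complex.norm_natCast, ← norm_mul]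
        have := norm_sub_le (n * D + χ (a ^ 2)) (χ (a ^ 2))
        rwa [add_sub_cancel_right] at this
      have h4 : (m : ℝ) * ‖D‖ ≤ n * ‖D‖ := by
        gcongr
        omega
      linarith
    have hD0 : D = 0 := by
      by_contra hne
      have hpos : 0 < ‖D‖ := norm_pos_iff.2 hne
      obtain ⟨m, hm⟩ := exists_nat_gt ((N ^ 2 + ‖χ (a ^ 2)‖) / ‖D‖)
      rw [div_lt_iff₀ hpos] at hm
      exact (key m).not_gt hm
    exact (sub_eq_zero.1 hD0).symm
  have h2 := hsq (a + b)
  have h3 : (a + b) ^ 2 = a ^ 2 + (2 : ℂ) • (a * b) + b ^ 2 := by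
    rw [ofNat_smul_eq_nsmul, nsmul_eq_mul]
    push_cast
    ring
  rw [h3, map_add, map_add, map_add, map_smul, hsq, hsq, smul_eq_mul] at h2
  linear_combination h2 / 2

lemma intervalIntegral_eq_circleAverage (f : ℂ → ℝ) (r : ℝ) :
    ∫ θ in (0 : ℝ)..(2 * π), f ((r : ℂ) * Complex.exp ((θ : ℂ) * Complex.I)) =
      2 * π * circleAverage f 0 r := by
  simp only [circleAverage_def, smul_eq_mul, mul_inv_cancel_left₀ two_pi_pos.ne', circleMap,
    zero_add]

lemma isOuter_exp_herglotzIntegral {u : ℂ → ℝ} (hu : CircleIntegrable u 0 1) :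
    IsOuter (unitDisk.domRestrict fun w => Complex.exp (herglotzIntegral u w)) := by
  refine ⟨⟨_, (differentiableOn_herglotzIntegral hu).cexp, fun _ => rfl⟩,
    fun θ => Real.exp (u (circleMap 0 1 θ)), fun θ => (Real.exp_pos _).le, ?_, fun z => ?_⟩
  · simp only [Real.log_exp]
    exact hu
  · simp [Set.domRestrict, herglotzIntegral, circleAverage_def, herglotzRieszKernel_def, circleMap]

lemma mem_hardy_of_norm_le {p : ℝ≥0∞} {F G : ℂ → ℂ} (hF : DifferentiableOn ℂ F unitDisk)
    (hG : unitDisk.domRestrict G ∈ hardy p) {K : ℝ} (hK : 0 ≤ K)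
    (h : ∀ w ∈ unitDisk, ‖F w‖ ≤ K * ‖G w‖) : unitDisk.domRestrict F ∈ hardy p := by
  obtain ⟨G', hG', hGG', hb⟩ := hG
  replace h : ∀ w ∈ unitDisk, ‖F w‖ ≤ K * ‖G' w‖ := fun w hw => by
    rw [← hGG' ⟨w, hw⟩]
    exact h w hw
  refine ⟨F, hF, fun _ => rfl, ?_⟩
  split_ifs at hb ⊢ with hp
  · obtain ⟨C, hC⟩ := hb
    exact ⟨K * C, fun z hz => (h z hz).trans (mul_le_mul_of_nonneg_left (hC z hz) hK)⟩
  · obtain ⟨C, hC⟩ := hb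
    refine ⟨K ^ p.toReal * C, fun r hr => ?_⟩
    have hci {f : ℂ → ℂ} (hf : DifferentiableOn ℂ f unitDisk) :
        CircleIntegrable (fun z => ‖f z‖ ^ p.toReal) 0 r :=
      ((hf.continuousOn.mono (sphere_subset_unit_ball hr)).norm.rpow_const
        fun _ _ => Or.inr ENNReal.toReal_nonneg).circleIntegrable'
    have hCr := hC r hr
    rw [intervalIntegral_eq_circleAverage (fun z => ‖G' z‖ ^ p.toReal)] at hCr
    rw [intervalIntegral_eq_circleAverage (fun z => ‖F z‖ ^ p.toReal)]
    have hle : circleAverage (fun z => ‖F z‖ ^ p.toReal) 0 r ≤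
        K ^ p.toReal * circleAverage (fun z => ‖G' z‖ ^ p.toReal) 0 r := by
      rw [← smul_eq_mul, ← circleAverage_fun_smul]
      refine circleAverage_mono (hci hF) ((hci hG').const_mul _) fun z hz => ?_
      rw [smul_eq_mul, ← Real.mul_rpow hK (norm_nonneg _)]
      exact Real.rpow_le_rpow (norm_nonneg _) (h z (sphere_subset_unit_ball hr hz))
        ENNReal.toReal_nonneg
    calc 2 * π * circleAverage (fun z => ‖F z‖ ^ p.toReal) 0 r
        ≤ 2 * π * (K ^ p.toReal * circleAverage (fun z => ‖G' z‖ ^ p.toReal) 0 r) := by gcongr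
      _ = K ^ p.toReal * (2 * π * circleAverage (fun z => ‖G' z‖ ^ p.toReal) 0 r) := by ring
      _ ≤ K ^ p.toReal * C := by gcongr

lemma one_mem_hardy (p : ℝ≥0∞) : unitDisk.domRestrict (fun _ => (1 : ℂ)) ∈ hardy p := by
  refine ⟨fun _ => 1, differentiableOn_const 1, fun _ => rfl, ?_⟩
  split_ifs
  · exact ⟨1, by simp⟩
  · exact ⟨2 * π, by simp⟩

lemma id_mem_hardy (p : ℝ≥0∞) : unitDisk.domRestrict (fun z => z) ∈ hardy p :=
  mem_hardy_of_norm_le differentiableOn_id (one_mem_hardy p) zero_le_one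
    fun w hw => by simpa using (mem_ball_zero_iff.1 hw).le

lemma norm_exp_herglotzIntegral {u : ℂ → ℝ} (hu : CircleIntegrable u 0 1) {w : ℂ}
    (hw : w ∈ ball (0 : ℂ) 1) :
    ‖Complex.exp (herglotzIntegral u w)‖ = Real.exp (poissonIntegral u w) := by
  rw [Complex.norm_exp, re_herglotzIntegral hu hw]

lemma herglotzIntegral_zero (w : ℂ) : herglotzIntegral (fun _ => 0) w = 0 := by
  simp [herglotzIntegral, circleAverage_const]

/-- Every function in `H^p` is dominated by an outer function in `H^p` which is bounded below. -/
lemma exists_norm_le_exp_herglotzIntegral {p : ℝ≥0∞} (hp : 0 < p) {F : ℂ → ℂ}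
    (hF : unitDisk.domRestrict F ∈ hardy p) :
    ∃ u : ℂ → ℝ, CircleIntegrable u 0 1 ∧
      unitDisk.domRestrict (fun w => Complex.exp (herglotzIntegral u w)) ∈ hardy p ∧
      (∀ w ∈ unitDisk, 1 ≤ ‖Complex.exp (herglotzIntegral u w)‖) ∧
      ∃ K : ℝ, ∀ w ∈ unitDisk, ‖F w‖ ≤ K * ‖Complex.exp (herglotzIntegral u w)‖ := by
  obtain ⟨F', hF', hFF', hb⟩ := hF
  replace hFF' : ∀ w ∈ unitDisk, F w = F' w := fun w hw => hFF' ⟨w, hw⟩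
  split_ifs at hb with hpt
  · obtain ⟨C, hC⟩ := hb
    refine ⟨fun _ => 0, circleIntegrable_const _ _ _, ?_, ?_, C, fun w hw => ?_⟩
    · simpa [herglotzIntegral_zero] using one_mem_hardy p
    · simp [herglotzIntegral_zero]
    · simpa [herglotzIntegral_zero, hFF' w hw] using hC w hw
  · obtain ⟨C, hC⟩ := hb
    have hp0 : 0 < p.toReal := ENNReal.toReal_pos hp.ne' hpt
    obtain ⟨u, hu, hfu, hCu⟩ := exists_norm_le_exp_poissonIntegral hF' hp0
      (C := (2 * π)⁻¹ * C) fun r hr => by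
        have := hC r hr
        rw [intervalIntegral_eq_circleAverage (fun z => ‖F' z‖ ^ p.toReal)] at this
        rwa [← div_eq_inv_mul, le_div_iff₀' two_pi_pos]
    refine ⟨u, hu, ⟨_, (differentiableOn_herglotzIntegral hu).cexp, fun _ => rfl, ?_⟩,
      fun w hw => ?_, 1, fun w hw => ?_⟩
    · rw [if_neg hpt]
      refine ⟨2 * π * (1 + (2 * π)⁻¹ * C), fun r hr => ?_⟩
      rw [intervalIntegral_eq_circleAverage
        (fun z => ‖Complex.exp (herglotzIntegral u z)‖ ^ p.toReal)]
      gcongr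
      refine (circleAverage_congr_sphere fun z hz => ?_).trans_le (hCu r hr)
      simp only [norm_exp_herglotzIntegral hu (sphere_subset_unit_ball hr hz)]
      rw [← Real.exp_mul, mul_comm]
    · rw [norm_exp_herglotzIntegral hu hw]
      exact Real.one_le_exp (hfu w hw).1
    · rw [one_mul, norm_exp_herglotzIntegral hu hw, hFF' w hw]
      exact (hfu w hw).2

/-- The real part of a holomorphic function with bounded imaginary part is bounded in `L²`. -/
lemma circleAverage_re_sq_le {b : ℂ → ℂ} (hb : DifferentiableOn ℂ b (ball 0 1)) {M : ℝ}
    (hM : ∀ w ∈ ball (0 : ℂ) 1, |(b w).im| ≤ M) {r : ℝ} (hr : r ∈ Ico (0 : ℝ) 1) :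
    circleAverage (fun ζ => (b ζ).re ^ 2) 0 r ≤ (b 0 ^ 2).re + M ^ 2 := by
  have hsub : closedBall (0 : ℂ) |r| ⊆ ball 0 1 := by
    rw [abs_of_nonneg hr.1]
    exact closedBall_subset_ball hr.2
  have hcont : ContinuousOn b (sphere 0 |r|) :=
    hb.continuousOn.mono (sphere_subset_unit_ball hr)
  have hsq : CircleIntegrable (fun ζ => b ζ ^ 2) 0 r := (hcont.pow 2).circleIntegrable'
  have hmean : circleAverage (fun ζ => b ζ ^ 2) 0 r = b 0 ^ 2 :=
    ((hb.pow 2).diffContOnCl_ball hsub).circleAverage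
  have hre : circleAverage (fun ζ => (b ζ ^ 2).re) 0 r = (b 0 ^ 2).re := by
    rw [← hmean]
    exact Complex.reCLM.circleAverage_comp_comm hsq
  have hci : CircleIntegrable (fun ζ => (b ζ ^ 2).re) 0 r :=
    (Complex.continuous_re.comp_continuousOn (hcont.pow 2)).circleIntegrable'
  rw [← hre, ← circleAverage_const (M ^ 2) 0 r,
    ← circleAverage_add hci (circleIntegrable_const _ _ _)]
  refine circleAverage_mono
    ((Complex.continuous_re.comp_continuousOn hcont).pow 2).circleIntegrable'
    (hci.add (circleIntegrable_const _ _ _)) fun ζ hζ => ?_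
  have := sq_le_sq' (abs_le.1 (hM ζ (sphere_subset_unit_ball hr hζ))).1
    (abs_le.1 (hM ζ (sphere_subset_unit_ball hr hζ))).2
  simp only [Pi.add_apply, sq, Complex.mul_re] at this ⊢
  linarith

/-- The algebra of functions that are holomorphic and bounded on the unit disk. -/
def boundedHol : Subalgebra ℂ (ℂ → ℂ) where
  carrier := {a | DifferentiableOn ℂ a unitDisk ∧ ∃ C : ℝ, 0 ≤ C ∧ ∀ w ∈ unitDisk, ‖a w‖ ≤ C}
  mul_mem' := by
    rintro a b ⟨ha, C, hC0, hC⟩ ⟨hb, D, hD0, hD⟩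
    refine ⟨ha.mul hb, C * D, mul_nonneg hC0 hD0, fun w hw => ?_⟩
    rw [Pi.mul_apply, norm_mul]
    exact mul_le_mul (hC w hw) (hD w hw) (norm_nonneg _) hC0
  add_mem' := by
    rintro a b ⟨ha, C, hC0, hC⟩ ⟨hb, D, hD0, hD⟩
    exact ⟨ha.add hb, C + D, add_nonneg hC0 hD0,
      fun w hw => (norm_add_le _ _).trans (add_le_add (hC w hw) (hD w hw))⟩
  algebraMap_mem' c :=
    ⟨differentiableOn_const c, ‖c‖, norm_nonneg c, fun _ _ => le_rfl⟩

lemma id_mem_boundedHol : (fun z => z) ∈ boundedHol :=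
  ⟨differentiableOn_id, 1, zero_le_one, fun _ hw => (mem_ball_zero_iff.1 hw).le⟩

lemma dslope_mem_boundedHol {a : ℂ → ℂ} (ha : a ∈ boundedHol) {w : ℂ} (hw : w ∈ unitDisk) :
    dslope a w ∈ boundedHol := by
  obtain ⟨ha, C, hC0, hC⟩ := ha
  have hd : DifferentiableOn ℂ (dslope a w) unitDisk :=
    (Complex.differentiableOn_dslope (isOpen_ball.mem_nhds hw)).2 ha
  obtain ⟨ε, hε, hsub⟩ := nhds_basis_closedBall.mem_iff.1 (isOpen_ball.mem_nhds hw)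
  obtain ⟨M, hM⟩ := (isCompact_closedBall w ε).exists_bound_of_continuousOn
    (hd.continuousOn.mono hsub)
  refine ⟨hd, max M ((C + C) / ε), le_max_of_le_right (by positivity), fun z hz => ?_⟩
  by_cases hzw : z ∈ closedBall w ε
  · exact (hM z hzw).trans (le_max_left _ _)
  · rw [mem_closedBall, not_le, dist_eq_norm] at hzw
    have hne : z ≠ w := by
      rintro rfl
      simp [hε.not_gt] at hzw
    refine le_trans ?_ (le_max_right _ _)
    rw [dslope_of_ne _ hne, slope_def_field, norm_div]
    exact div_le_div₀ (by positivity)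
      ((norm_sub_le _ _).trans (add_le_add (hC z hz) (hC w hw))) hε hzw.le

/-- A linear functional on `H^p` that does not vanish at outer functions. -/
structure IsOuterNonvanishing (p : ℝ≥0∞) (Λ : (unitDisk → ℂ) → ℂ) : Prop where
  protected map_add : ∀ f ∈ hardy p, ∀ g ∈ hardy p, Λ (f + g) = Λ f + Λ g
  protected map_smul : ∀ (c : ℂ), ∀ f ∈ hardy p, Λ (c • f) = c * Λ f
  ne_zero : ∀ g ∈ hardy p, IsOuter g → Λ g ≠ 0

namespace IsOuterNonvanishing

variable {p : ℝ≥0∞} {Λ : (unitDisk → ℂ) → ℂ} {u : ℂ → ℝ}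

lemma map_one_ne_zero (hΛ : IsOuterNonvanishing p Λ) :
    Λ (unitDisk.domRestrict fun _ => (1 : ℂ)) ≠ 0 := by
  refine hΛ.ne_zero _ (one_mem_hardy p) ?_
  simpa [herglotzIntegral_zero] using
    isOuter_exp_herglotzIntegral (circleIntegrable_const (0 : ℝ) 0 1)

lemma map_mul_exp_ne_zero (hΛ : IsOuterNonvanishing p Λ) (hu : CircleIntegrable u 0 1)
    {b : ℂ → ℂ} (hb : DifferentiableOn ℂ b unitDisk) {M : ℝ}
    (hM : ∀ w ∈ unitDisk, |(b w).im| ≤ M)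
    (hmem : unitDisk.domRestrict (fun w => Complex.exp (b w) *
      Complex.exp (herglotzIntegral u w)) ∈ hardy p) :
    Λ (unitDisk.domRestrict fun w => Complex.exp (b w) *
      Complex.exp (herglotzIntegral u w)) ≠ 0 := by
  obtain ⟨v, c, hv, hbv⟩ := exists_herglotzIntegral_add_const hb
    fun r hr => circleAverage_re_sq_le hb hM hr
  have huv : CircleIntegrable (fun ζ => v ζ + u ζ) 0 1 := hv.add hu
  have heq (w : ℂ) (hw : w ∈ unitDisk) : Complex.exp (b w) * Complex.exp (herglotzIntegral u w) =
      Complex.exp c * Complex.exp (herglotzIntegral (fun ζ => v ζ + u ζ) w) := by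
    rw [hbv w hw, herglotzIntegral_add hv hu hw, ← Complex.exp_add, ← Complex.exp_add]
    ring_nf
  have hmem' : unitDisk.domRestrict
      (fun w => Complex.exp (herglotzIntegral (fun ζ => v ζ + u ζ) w)) ∈ hardy p := by
    refine mem_hardy_of_norm_le (differentiableOn_herglotzIntegral huv).cexp hmem
      (norm_nonneg (Complex.exp (-c))) fun w hw => ?_
    rw [heq w hw, ← norm_mul, ← mul_assoc, ← Complex.exp_add, neg_add_cancel, Complex.exp_zero,
      one_mul]
  have hsmul : (unitDisk.domRestrict fun w => Complex.exp (b w) *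
      Complex.exp (herglotzIntegral u w)) = Complex.exp c • unitDisk.domRestrict
        (fun w => Complex.exp (herglotzIntegral (fun ζ => v ζ + u ζ) w)) :=
    funext fun w => heq w w.2
  rw [hsmul, hΛ.map_smul _ _ hmem']
  exact mul_ne_zero (Complex.exp_ne_zero c)
    (hΛ.ne_zero _ hmem' (isOuter_exp_herglotzIntegral huv))

lemma mul_mem_hardy {g : ℂ → ℂ} (hgd : DifferentiableOn ℂ g unitDisk)
    (hg : unitDisk.domRestrict g ∈ hardy p) {a : ℂ → ℂ} (ha : a ∈ boundedHol) :
    unitDisk.domRestrict (a * g) ∈ hardy p := by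
  obtain ⟨had, C, hC0, hC⟩ := ha
  refine mem_hardy_of_norm_le (had.mul hgd) hg hC0 fun w hw => ?_
  rw [Pi.mul_apply, norm_mul]
  exact mul_le_mul_of_nonneg_right (hC w hw) (norm_nonneg _)

lemma map_sub_pow_mul_ne_zero (hΛ : IsOuterNonvanishing p Λ) (hu : CircleIntegrable u 0 1)
    (hmem : unitDisk.domRestrict (fun w => Complex.exp (herglotzIntegral u w)) ∈ hardy p)
    {a : ℂ → ℂ} (ha : a ∈ boundedHol) {c : ℂ} (hac : ∀ w ∈ unitDisk, ‖a w‖ < ‖c‖) (n : ℕ) :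
    Λ (unitDisk.domRestrict ((algebraMap ℂ (ℂ → ℂ) c - a) ^ n *
      fun w => Complex.exp (herglotzIntegral u w))) ≠ 0 := by
  have hc : c ≠ 0 := by
    rintro rfl
    simpa using (norm_nonneg _).trans_lt (hac 0 (mem_ball_self one_pos))
  have hre (w : ℂ) (hw : w ∈ unitDisk) : 0 < (1 - a w / c).re := by
    have h1 : ‖a w / c‖ < 1 := by
      rw [norm_div, div_lt_one (norm_pos_iff.2 hc)]
      exact hac w hw
    rw [Complex.sub_re, Complex.one_re, sub_pos]
    exact (Complex.re_le_norm _).trans_lt h1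
  let b (w : ℂ) : ℂ := n * Complex.log (1 - a w / c)
  have hb : DifferentiableOn ℂ b unitDisk :=
    (((ha.1.div_const c).const_sub 1).clog fun w hw => Or.inl (hre w hw)).const_mul _
  have hbexp (w : ℂ) (hw : w ∈ unitDisk) : Complex.exp (b w) = (1 - a w / c) ^ n := by
    rw [Complex.exp_nat_mul, Complex.exp_log]
    intro h
    simpa [h] using hre w hw
  have hbim (w : ℂ) (_ : w ∈ unitDisk) : |(b w).im| ≤ n * π := by
    simp only [b, ← Complex.ofReal_natCast, Complex.im_ofReal_mul, abs_mul, Nat.abs_cast]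
    gcongr
    simpa only [Complex.log_im] using Complex.abs_arg_le_pi _
  have hca : (algebraMap ℂ (ℂ → ℂ) c - a) ^ n ∈ boundedHol :=
    pow_mem (sub_mem (algebraMap_mem _ c) ha) n
  have hgd := (differentiableOn_herglotzIntegral hu).cexp
  have heq : (unitDisk.domRestrict ((algebraMap ℂ (ℂ → ℂ) c - a) ^ n *
      fun w => Complex.exp (herglotzIntegral u w))) = c ^ n • unitDisk.domRestrict fun w =>
        Complex.exp (b w) * Complex.exp (herglotzIntegral u w) := by
    ext w
    simp only [domRestrict_apply, Pi.mul_apply, Pi.pow_apply, Pi.sub_apply, Pi.algebraMap_apply,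
      Algebra.algebraMap_self, RingHom.id_apply, Pi.smul_apply, smul_eq_mul, hbexp w w.2]
    rw [← mul_assoc, ← mul_pow, mul_sub, mul_one, mul_div_cancel₀ _ hc]
  have hmemb : unitDisk.domRestrict (fun w => Complex.exp (b w) *
      Complex.exp (herglotzIntegral u w)) ∈ hardy p := by
    refine mem_hardy_of_norm_le (hb.cexp.mul hgd) (mul_mem_hardy hgd hmem hca)
      (norm_nonneg (c ^ n)⁻¹) fun w hw => ?_
    have := congrFun heq ⟨w, hw⟩
    simp only [domRestrict_apply, Pi.smul_apply, smul_eq_mul] at this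
    rw [this, ← norm_mul, inv_mul_cancel_left₀ (pow_ne_zero n hc)]
  rw [heq, hΛ.map_smul _ _ hmemb]
  exact mul_ne_zero (pow_ne_zero n hc) (hΛ.map_mul_exp_ne_zero hu hb hbim hmemb)

lemma exists_map_mul_eq (hΛ : IsOuterNonvanishing p Λ) (hu : CircleIntegrable u 0 1)
    (hmem : unitDisk.domRestrict (fun w => Complex.exp (herglotzIntegral u w)) ∈ hardy p) :
    ∃ w ∈ unitDisk, ∀ a ∈ boundedHol,
      Λ (unitDisk.domRestrict (a * fun w => Complex.exp (herglotzIntegral u w))) =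
        a w * Λ (unitDisk.domRestrict fun w => Complex.exp (herglotzIntegral u w)) := by
  set g : ℂ → ℂ := fun w => Complex.exp (herglotzIntegral u w)
  have hgd : DifferentiableOn ℂ g unitDisk := (differentiableOn_herglotzIntegral hu).cexp
  have hΛg : Λ (unitDisk.domRestrict g) ≠ 0 :=
    hΛ.ne_zero _ hmem (isOuter_exp_herglotzIntegral hu)
  let χ : boundedHol →ₗ[ℂ] ℂ :=
    { toFun := fun a => Λ (unitDisk.domRestrict ((a : ℂ → ℂ) * g)) / Λ (unitDisk.domRestrict g)
      map_add' := fun a b => by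
        rw [← add_div, ← hΛ.map_add _ (mul_mem_hardy hgd hmem a.2) _
          (mul_mem_hardy hgd hmem b.2), Subalgebra.coe_add, add_mul]
        rfl
      map_smul' := fun c a => by
        rw [RingHom.id_apply, smul_eq_mul, ← mul_div_assoc,
          ← hΛ.map_smul _ _ (mul_mem_hardy hgd hmem a.2), Subalgebra.coe_smul, smul_mul_assoc]
        rfl }
  have hχ (a : boundedHol) :
      Λ (unitDisk.domRestrict ((a : ℂ → ℂ) * g)) = χ a * Λ (unitDisk.domRestrict g) :=
    (div_mul_cancel₀ _ hΛg).symm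
  have hχ1 : χ 1 = 1 := by
    simp [χ, hΛg]
  have hpow (a : boundedHol) (c : ℂ) (hac : ∀ w ∈ unitDisk, ‖(a : ℂ → ℂ) w‖ < ‖c‖) (n : ℕ) :
      χ ((algebraMap ℂ boundedHol c - a) ^ n) ≠ 0 :=
    div_ne_zero (hΛ.map_sub_pow_mul_ne_zero hu hmem a.2 hac n) hΛg
  have hmul := map_mul_of_map_sub_pow_ne_zero χ hχ1 fun a => by
    obtain ⟨C, -, hC⟩ := a.2.2
    exact ⟨C, fun c n hc => hpow a c (fun w hw => (hC w hw).trans_lt hc) n⟩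
  have hχc (c : ℂ) : χ (algebraMap ℂ boundedHol c) = c := by
    rw [Algebra.algebraMap_eq_smul_one, map_smul, hχ1, smul_eq_mul, mul_one]
  let z : boundedHol := ⟨_, id_mem_boundedHol⟩
  have hw : χ z ∈ unitDisk := by
    by_contra hw
    rw [unitDisk, mem_ball_zero_iff, not_lt] at hw
    refine hpow z (χ z) (fun w hw' => (mem_ball_zero_iff.1 hw').trans_le hw) 1 ?_
    rw [pow_one, map_sub, hχc, sub_self]
  refine ⟨χ z, hw, fun a ha => ?_⟩
  rw [hχ ⟨a, ha⟩]
  congr 1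
  have hdecomp : (⟨a, ha⟩ : boundedHol) = algebraMap ℂ boundedHol (a (χ z)) +
      (z - algebraMap ℂ boundedHol (χ z)) * ⟨_, dslope_mem_boundedHol ha hw⟩ := by
    ext x
    have := sub_smul_dslope a (χ z) x
    rw [smul_eq_mul] at this
    change a x = a (χ z) + (x - χ z) * dslope a (χ z) x
    rw [this, add_sub_cancel]
  rw [hdecomp, map_add, hmul, map_sub, hχc, hχc, sub_self, zero_mul, add_zero]

/-- A linear functional on `H^p` that does not vanish at outer functions is a multiple of a point
evaluation. -/
theorem exists_eq_map_one_mul (hΛ : IsOuterNonvanishing p Λ) (hp : 0 < p) {f : unitDisk → ℂ}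
    (hf : f ∈ hardy p) :
    ∃ w : unitDisk,
      Λ (unitDisk.domRestrict fun z => z) = Λ (unitDisk.domRestrict fun _ => (1 : ℂ)) * w ∧
      Λ f = Λ (unitDisk.domRestrict fun _ => (1 : ℂ)) * f w := by
  obtain ⟨F, hFd, hfF⟩ : HolOn f := hf.imp fun F hF => ⟨hF.1, hF.2.1⟩
  obtain rfl : f = unitDisk.domRestrict F := funext hfF
  obtain ⟨u, hu, hmem, hge, K, hK⟩ := exists_norm_le_exp_herglotzIntegral hp hf
  obtain ⟨w, hw, hΛw⟩ := hΛ.exists_map_mul_eq hu hmem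
  have hgd : DifferentiableOn ℂ (fun w => Complex.exp (herglotzIntegral u w)) unitDisk :=
    (differentiableOn_herglotzIntegral hu).cexp
  set g : ℂ → ℂ := fun w => Complex.exp (herglotzIntegral u w)
  have hg0 (x : ℂ) : g x ≠ 0 := Complex.exp_ne_zero _
  have hdiv {h : ℂ → ℂ} {L : ℝ} (hh : DifferentiableOn ℂ h unitDisk)
      (hL : ∀ x ∈ unitDisk, ‖h x‖ ≤ L * ‖g x‖) :
      Λ (unitDisk.domRestrict h) = h w / g w * Λ (unitDisk.domRestrict g) := by
    have hb : h / g ∈ boundedHol := by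
      refine ⟨hh.div hgd fun x _ => hg0 x, |L|, abs_nonneg L, fun x hx => ?_⟩
      rw [Pi.div_apply, norm_div, div_le_iff₀ (norm_pos_iff.2 (hg0 x))]
      exact (hL x hx).trans (mul_le_mul_of_nonneg_right (le_abs_self L) (norm_nonneg _))
    have hhg : h / g * g = h := funext fun x => div_mul_cancel₀ _ (hg0 x)
    rw [← Pi.div_apply, ← hΛw _ hb, hhg]
  have h1 := hdiv (h := fun _ => 1) (L := 1) (differentiableOn_const 1)
    fun x hx => by simpa using hge x hx
  have hz := hdiv (h := fun z => z) (L := 1) differentiableOn_id fun x hx => by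
    rw [one_mul]
    exact (mem_ball_zero_iff.1 hx).le.trans (hge x hx)
  refine ⟨⟨w, hw⟩, ?_, ?_⟩
  · rw [hz, h1]
    ring
  · rw [hdiv hFd hK, h1, domRestrict_apply]
    ring

end IsOuterNonvanishing

/-- **Weighted composition operators on Hardy spaces.** For `0 < p ≤ ∞`, a ℂ-linear map
`T : H^p → hol(𝔻)` (not assumed continuous) such that `(Tg)(z) ≠ 0` for every outer
`g ∈ H^p` and every `z ∈ 𝔻` is a weighted composition operator: `Tf = ψ · (f ∘ φ)` for
holomorphic `φ : 𝔻 → 𝔻` and `ψ : 𝔻 → ℂ∖{0}`. -/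
theorem hardy_weighted_composition (p : ℝ≥0∞) (hp : 0 < p)
    (T : (unitDisk → ℂ) → (unitDisk → ℂ))
    (hThol : ∀ f ∈ hardy p, HolOn (T f))
    (hadd : ∀ f g : unitDisk → ℂ, f ∈ hardy p → g ∈ hardy p → T (f + g) = T f + T g)
    (hsmul : ∀ (c : ℂ) (f : unitDisk → ℂ), f ∈ hardy p → T (c • f) = c • T f)
    (hne : ∀ g ∈ hardy p, IsOuter g → ∀ z : unitDisk, T g z ≠ 0) :
    ∃ (φ : unitDisk → unitDisk) (ψ : unitDisk → ℂ),
      HolOn (fun z => (φ z : ℂ)) ∧ HolOn ψ ∧ (∀ z : unitDisk, ψ z ≠ 0) ∧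
      ∀ f ∈ hardy p, ∀ z : unitDisk, T f z = ψ z * f (φ z) := by
  have hΛ (z : unitDisk) : IsOuterNonvanishing p fun f => T f z :=
    ⟨fun f hf g hg => congrFun (hadd f g hf hg) z, fun c f hf => congrFun (hsmul c f hf) z,
      fun g hg ho => hne g hg ho z⟩
  choose φ hφ using fun z => (hΛ z).exists_eq_map_one_mul hp (id_mem_hardy p)
  refine ⟨φ, T (unitDisk.domRestrict fun _ => (1 : ℂ)), ?_, hThol _ (one_mem_hardy p),
    fun z => (hΛ z).map_one_ne_zero, fun f hf z => ?_⟩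
  · obtain ⟨F, hF, hTF⟩ := hThol _ (id_mem_hardy p)
    obtain ⟨G, hG, hTG⟩ := hThol _ (one_mem_hardy p)
    refine ⟨F / G, hF.div hG fun z hz => ?_, fun z => ?_⟩
    · rw [← hTG ⟨z, hz⟩]
      exact (hΛ ⟨z, hz⟩).map_one_ne_zero
    · rw [Pi.div_apply, ← hTF, ← hTG, (hφ z).1]
      exact (mul_div_cancel_left₀ _ (hΛ z).map_one_ne_zero).symm
  · obtain ⟨w, hw, hfw⟩ := (hΛ z).exists_eq_map_one_mul hp hf
    have : φ z = w := Subtype.ext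
      (mul_left_cancel₀ (hΛ z).map_one_ne_zero ((hφ z).1.symm.trans hw))
    rw [this]
    exact hfw
end
end
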